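/- Let Δ be a d-dimensional connected simplicial complex such that 𝕜[Δ] is Gorenstein on the punctured spectrum. If Δ is a pseudomanifold, then Δ is a 𝕜-homology manifold. -/

import Mathlib

/-! # Preliminaries

Self-contained definitions: simplicial complexes, simplicial homology, Stanley–Reisner rings,
canonical modules, canonical traces, and the various Gorenstein-type conditions. -/

open CategoryTheory

/-- An abstract simplicial complex on the vertex set `Fin n` (the empty set is a face). -/
structure SC (n : ℕ) where
  faces : Finset (Finset (Fin n))
  empty_mem : ∅ ∈ faces
  down_closed : ∀ {σ τ : Finset (Fin n)}, σ ∈ faces → τ ⊆ σ → τ ∈ faces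

namespace SC

variable {n : ℕ} (Δ : SC n)

/-- The dimension of a simplicial complex, as an integer (the complex `{∅}` has
dimension `-1`). -/
def dim : ℤ := ((Δ.faces.sup Finset.card : ℕ) : ℤ) - 1

/-- `v` is a vertex of `Δ`. -/
def IsVertex (v : Fin n) : Prop := {v} ∈ Δ.faces

/-- A facet is a face which is maximal by inclusion. -/
def IsFacet (σ : Finset (Fin n)) : Prop :=
  σ ∈ Δ.faces ∧ ∀ τ ∈ Δ.faces, σ ⊆ τ → σ = τ

/-- A cone point is a vertex contained in every facet. -/
def IsConePoint (v : Fin n) : Prop :=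
  Δ.IsVertex v ∧ ∀ σ, Δ.IsFacet σ → v ∈ σ

/-- A simplicial complex is connected if it has a vertex and any two vertices are joined
by a path of edges. -/
def Connected : Prop :=
  (∃ v, Δ.IsVertex v) ∧ ∀ u v, Δ.IsVertex u → Δ.IsVertex v →
    Relation.ReflTransGen (fun a b => ({a, b} : Finset (Fin n)) ∈ Δ.faces) u v

/-- A simplicial complex is strongly connected if any two facets are joined by a chain of
facets in which consecutive facets intersect in a face of dimension `dim Δ - 1`. -/
def StronglyConnected : Prop :=
  ∀ σ τ, Δ.IsFacet σ → Δ.IsFacet τ →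
    Relation.ReflTransGen
      (fun α β => Δ.IsFacet α ∧ Δ.IsFacet β ∧ ((α ∩ β).card : ℤ) - 1 = Δ.dim - 1) σ τ

/-- A pseudomanifold: strongly connected, and every face of dimension `dim Δ - 1` is
contained in exactly two facets. -/
def IsPseudomanifold : Prop :=
  Δ.StronglyConnected ∧
    ∀ τ ∈ Δ.faces, (τ.card : ℤ) - 1 = Δ.dim - 1 →
      {σ : Finset (Fin n) | Δ.IsFacet σ ∧ τ ⊆ σ}.ncard = 2

/-- The link of a face `σ` of `Δ`. -/
def link (σ : Finset (Fin n)) (hσ : σ ∈ Δ.faces) : SC n where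
  faces := Δ.faces.filter fun τ => τ ∩ σ = ∅ ∧ τ ∪ σ ∈ Δ.faces
  empty_mem := by
    simp only [Finset.mem_filter]
    exact ⟨Δ.empty_mem, by simp, by simpa using hσ⟩
  down_closed := by
    intro σ' τ' h hsub
    simp only [Finset.mem_filter] at h ⊢
    refine ⟨Δ.down_closed h.1 hsub, ?_, ?_⟩
    · have := h.2.1
      rw [Finset.eq_empty_iff_forall_notMem] at this ⊢
      intro x hx
      exact this x (Finset.mem_inter.mpr
        ⟨hsub (Finset.mem_inter.mp hx).1, (Finset.mem_inter.mp hx).2⟩)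
    · exact Δ.down_closed h.2.2 (Finset.union_subset_union hsub (le_refl σ))

/-- A complex is normal if the link of every face of dimension `≤ dim Δ - 2` is connected. -/
def Normal : Prop :=
  ∀ σ (hσ : σ ∈ Δ.faces), (σ.card : ℤ) - 1 ≤ Δ.dim - 2 → (Δ.link σ hσ).Connected

/-! ## Simplicial homology -/

/-- Faces of `Δ` of cardinality `c` containing the face `σ`.  These index a basis of the
`c`-th chain group of the pair `(Δ, cost_Δ σ)` (for `σ = ∅` this is the augmented
(reduced) chain complex of `Δ`, since the empty face is included in chain degree `0`). -/
def RFace (σ : Finset (Fin n)) (c : ℕ) : Type :=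
  {τ : Finset (Fin n) // τ ∈ Δ.faces ∧ σ ⊆ τ ∧ τ.card = c}

instance (σ : Finset (Fin n)) (c : ℕ) : Fintype (Δ.RFace σ c) :=
  inferInstanceAs (Fintype {τ : Finset (Fin n) // τ ∈ Δ.faces ∧ σ ⊆ τ ∧ τ.card = c})

instance (σ : Finset (Fin n)) (c : ℕ) : DecidableEq (Δ.RFace σ c) :=
  inferInstanceAs (DecidableEq {τ : Finset (Fin n) // τ ∈ Δ.faces ∧ σ ⊆ τ ∧ τ.card = c})

variable (R : Type) [CommRing R]

/-- Chains of the pair `(Δ, cost_Δ σ)` with coefficients in `R`. -/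
abbrev relChain (σ : Finset (Fin n)) (c : ℕ) : Type := Δ.RFace σ c → R

/-- The matrix of the simplicial boundary map of the pair `(Δ, cost_Δ σ)`: the coefficient of
`ρ` in `∂ τ` is `(-1)^j` if `ρ` is obtained from `τ` by deleting its `(j+1)`-st vertex (the
deleted vertex not belonging to `σ`), and `0` otherwise. -/
def relBMat (σ : Finset (Fin n)) (i : ℕ) :
    Matrix (Δ.RFace σ i) (Δ.RFace σ (i + 1)) R :=
  fun ρ τ => ∑ v ∈ τ.1, if v ∉ σ ∧ τ.1.erase v = ρ.1
    then (-1 : R) ^ ((τ.1.filter (fun w => w < v)).card) else 0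

/-- The boundary map of the chain complex of the pair `(Δ, cost_Δ σ)`. -/
noncomputable def relBoundary (σ : Finset (Fin n)) (i : ℕ) :
    Δ.relChain R σ (i + 1) →ₗ[R] Δ.relChain R σ i :=
  (Δ.relBMat R σ i).mulVecLin

/-- The relative simplicial homology `H_d(Δ, cost_Δ σ; R)` (`d ≥ 0`). -/
noncomputable def relHomology (σ : Finset (Fin n)) (d : ℕ) : Type :=
  LinearMap.ker (Δ.relBoundary R σ d) ⧸
    Submodule.comap (LinearMap.ker (Δ.relBoundary R σ d)).subtype
      (LinearMap.range (Δ.relBoundary R σ (d + 1)))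

noncomputable instance (σ : Finset (Fin n)) (d : ℕ) : AddCommGroup (Δ.relHomology R σ d) :=
  inferInstanceAs (AddCommGroup (LinearMap.ker (Δ.relBoundary R σ d) ⧸
    Submodule.comap (LinearMap.ker (Δ.relBoundary R σ d)).subtype
      (LinearMap.range (Δ.relBoundary R σ (d + 1)))))

noncomputable instance (σ : Finset (Fin n)) (d : ℕ) : Module R (Δ.relHomology R σ d) :=
  inferInstanceAs (Module R (LinearMap.ker (Δ.relBoundary R σ d) ⧸
    Submodule.comap (LinearMap.ker (Δ.relBoundary R σ d)).subtype
      (LinearMap.range (Δ.relBoundary R σ (d + 1)))))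

/-- Reduced simplicial homology `H̃_d(Δ; R)` for `d ≥ 0`: the homology of the augmented chain
complex, i.e. of the pair `(Δ, cost_Δ ∅)`. -/
noncomputable abbrev reducedHomology (d : ℕ) : Type := Δ.relHomology R ∅ d

/-- Reduced simplicial homology in degree `-1`. -/
noncomputable def reducedHomologyNeg : Type :=
  (⊤ : Submodule R (Δ.relChain R ∅ 0)) ⧸
    Submodule.comap (⊤ : Submodule R (Δ.relChain R ∅ 0)).subtype
      (LinearMap.range (Δ.relBoundary R ∅ 0))

noncomputable instance : AddCommGroup (Δ.reducedHomologyNeg R) :=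
  inferInstanceAs (AddCommGroup ((⊤ : Submodule R (Δ.relChain R ∅ 0)) ⧸
    Submodule.comap (⊤ : Submodule R (Δ.relChain R ∅ 0)).subtype
      (LinearMap.range (Δ.relBoundary R ∅ 0))))

noncomputable instance : Module R (Δ.reducedHomologyNeg R) :=
  inferInstanceAs (Module R ((⊤ : Submodule R (Δ.relChain R ∅ 0)) ⧸
    Submodule.comap (⊤ : Submodule R (Δ.relChain R ∅ 0)).subtype
      (LinearMap.range (Δ.relBoundary R ∅ 0))))

/-- Cycles of the non-augmented chain complex of `Δ` in dimension `d` (for `d = 0` every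
`0`-chain is a cycle). -/
noncomputable def cyclesUnred (d : ℕ) : Submodule R (Δ.relChain R ∅ (d + 1)) :=
  if d = 0 then ⊤ else LinearMap.ker (Δ.relBoundary R ∅ d)

/-- (Unreduced) simplicial homology `H_d(Δ; R)`. -/
noncomputable def homologyUnred (d : ℕ) : Type :=
  Δ.cyclesUnred R d ⧸
    Submodule.comap (Δ.cyclesUnred R d).subtype (LinearMap.range (Δ.relBoundary R ∅ (d + 1)))

noncomputable instance (d : ℕ) : AddCommGroup (Δ.homologyUnred R d) :=
  inferInstanceAs (AddCommGroup (Δ.cyclesUnred R d ⧸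
    Submodule.comap (Δ.cyclesUnred R d).subtype (LinearMap.range (Δ.relBoundary R ∅ (d + 1)))))

noncomputable instance (d : ℕ) : Module R (Δ.homologyUnred R d) :=
  inferInstanceAs (Module R (Δ.cyclesUnred R d ⧸
    Submodule.comap (Δ.cyclesUnred R d).subtype (LinearMap.range (Δ.relBoundary R ∅ (d + 1)))))

/-- `Δ` is `R`-orientable if `H_d(Δ; R) ≠ 0`, where `d = dim Δ`. -/
def Orientable : Prop :=
  ∃ d : ℕ, Δ.dim = (d : ℤ) ∧ Nontrivial (Δ.homologyUnred R d)

/-- A `k`-homology sphere condition for a single complex `Γ`: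
`H̃_i(Γ; k) = k` for `i = dim Γ` and `0` otherwise. -/
def HomologySphereCond (Γ : SC n) : Prop :=
  (∀ i : ℕ, ((i : ℤ) = Γ.dim → Nonempty ((Γ.reducedHomology R i) ≃ₗ[R] R)) ∧
    ((i : ℤ) ≠ Γ.dim → Subsingleton (Γ.reducedHomology R i))) ∧
  ((-1 : ℤ) = Γ.dim → Nonempty ((Γ.reducedHomologyNeg R) ≃ₗ[R] R)) ∧
  ((-1 : ℤ) ≠ Γ.dim → Subsingleton (Γ.reducedHomologyNeg R))

/-- `Δ` is a `k`-homology manifold: it is connected and the link of every nonempty face has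
the reduced homology of a sphere of its dimension. -/
def IsHomologyManifold : Prop :=
  Δ.Connected ∧ ∀ σ (hσ : σ ∈ Δ.faces), σ ≠ ∅ → HomologySphereCond R (Δ.link σ hσ)

/-- `Δ` is isomorphic to the disjoint union of `m` vertices. -/
def IsDisjointVertices (m : ℕ) : Prop :=
  ∃ v : Fin m → Fin n, Function.Injective v ∧
    ∀ σ : Finset (Fin n), σ ∈ Δ.faces ↔ (σ = ∅ ∨ ∃ i, σ = {v i})

/-- `Δ` is isomorphic to a path of length `m` (with `m` edges and `m+1` vertices). -/
def IsPathComplex (m : ℕ) : Prop :=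
  ∃ v : Fin (m + 1) → Fin n, Function.Injective v ∧
    ∀ σ : Finset (Fin n), σ ∈ Δ.faces ↔
      (σ = ∅ ∨ (∃ i, σ = {v i}) ∨ ∃ i : Fin m, σ = {v i.castSucc, v i.succ})

end SC

/-! ## Commutative algebra -/

/-- The `i`-th Ext module `Ext^i_R(M, N)` of two `R`-modules, as an object of `ModuleCat R`. -/
noncomputable def extMod (R : Type) [CommRing R] (M N : Type) [AddCommGroup M] [Module R M]
    [AddCommGroup N] [Module R N] (i : ℕ) : ModuleCat R :=
  ((Ext R (ModuleCat R) i).obj (Opposite.op (ModuleCat.of R M))).obj (ModuleCat.of R N)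

/-- The trace ideal of an `R`-module `M`: the sum of the images of all `R`-linear maps
`M → R`. -/
noncomputable def traceIdeal (R : Type) [CommRing R] (M : Type) [AddCommGroup M] [Module R M] :
    Ideal R :=
  ⨆ f : M →ₗ[R] R, LinearMap.range f

/-- A Noetherian ring `R` with a distinguished maximal ideal `𝔪` (a local ring, or a graded
ring with its graded maximal ideal) is Cohen--Macaulay when `depth = dim`, i.e. (by the
Ext-characterisation of depth) `Ext^i_R(R/𝔪, R) = 0` for all `i < dim R`. -/
def IsCohenMacaulayAt (R : Type) [CommRing R] (𝔪 : Ideal R) : Prop :=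
  IsNoetherianRing R ∧
    ∀ i : ℕ, (i : WithBot (WithTop ℕ)) < ringKrullDim R → Subsingleton (extMod R (R ⧸ 𝔪) R i)

/-- A Noetherian ring `R` with a distinguished maximal ideal `𝔪` (a local ring, or a graded
ring with its graded maximal ideal) is Gorenstein when `Ext^i_R(R/𝔪, R)` vanishes for
`i ≠ dim R` and is isomorphic to `R/𝔪` for `i = dim R`. -/
def IsGorensteinAt (R : Type) [CommRing R] (𝔪 : Ideal R) : Prop :=
  IsNoetherianRing R ∧
    ∀ i : ℕ, ((i : WithBot (WithTop ℕ)) = ringKrullDim R →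
        Nonempty ((extMod R (R ⧸ 𝔪) R i) ≃ₗ[R] (R ⧸ 𝔪))) ∧
      ((i : WithBot (WithTop ℕ)) ≠ ringKrullDim R → Subsingleton (extMod R (R ⧸ 𝔪) R i))

/-- A Noetherian local ring is Gorenstein. -/
def IsGorensteinLocalRing (A : Type) [CommRing A] [IsLocalRing A] : Prop :=
  IsGorensteinAt A (IsLocalRing.maximalIdeal A)

section Graded

variable (k : Type) [Field k] {n : ℕ}

/-- An ideal of a polynomial ring is homogeneous (graded) if it contains all homogeneous
components of its elements. -/
def IsHomogIdeal (I : Ideal (MvPolynomial (Fin n) k)) : Prop :=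
  ∀ p ∈ I, ∀ d : ℕ, MvPolynomial.homogeneousComponent d p ∈ I

/-- The graded (irrelevant) maximal ideal of `k[x_1,…,x_n]/I`, generated by the images of the
variables. -/
noncomputable def quotMax (I : Ideal (MvPolynomial (Fin n) k)) :
    Ideal (MvPolynomial (Fin n) k ⧸ I) :=
  Ideal.span (Set.range fun i : Fin n => Ideal.Quotient.mk I (MvPolynomial.X i))

/-- The degree `j` component of the standard graded ring `k[x_1,…,x_n]/I`, as a
`k`-subspace. -/
noncomputable def quotGrade (I : Ideal (MvPolynomial (Fin n) k)) (j : ℕ) :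
    Submodule k (MvPolynomial (Fin n) k ⧸ I) :=
  (MvPolynomial.homogeneousSubmodule (Fin n) k j).map (Ideal.Quotient.mkₐ k I).toLinearMap

/-- The `ℤ^n`-graded component of `k[x_1,…,x_n]/I` of multidegree `a`: the `k`-line spanned by
the image of the monomial `x^a`. -/
noncomputable def quotMonomialGrade (I : Ideal (MvPolynomial (Fin n) k)) (a : Fin n → ℕ) :
    Submodule k (MvPolynomial (Fin n) k ⧸ I) :=
  Submodule.span k
    {Ideal.Quotient.mk I (MvPolynomial.monomial (Finsupp.equivFunOnFinite.symm a) (1 : k))}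

/-- The standard graded ring `R = k[x_1,…,x_n]/I` is Gorenstein on the punctured spectrum if
`R_𝔭` is Gorenstein for every graded prime `𝔭` other than the graded maximal ideal. -/
def GorensteinPunctured (I : Ideal (MvPolynomial (Fin n) k)) : Prop :=
  ∀ (𝔭 : Ideal (MvPolynomial (Fin n) k ⧸ I)) [𝔭.IsPrime],
    IsHomogIdeal k (𝔭.comap (Ideal.Quotient.mk I)) → 𝔭 ≠ quotMax k I →
      IsGorensteinLocalRing (Localization.AtPrime 𝔭)

/-- `ω` is a canonical module of the standard graded ring `R = k[x_1,…,x_n]/I`, `d = dim R`,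
when `ω ≅ Ext^{n-d}_S(R, S)` for `S = k[x_1,…,x_n]` (by graded local duality this is, up to
shift, the Matlis dual of the top local cohomology module `H^d_𝔪(R)`). -/
def IsCanonicalModuleQ (I : Ideal (MvPolynomial (Fin n) k)) (ω : Type) [AddCommGroup ω]
    [Module (MvPolynomial (Fin n) k ⧸ I) ω] : Prop :=
  Module.Finite (MvPolynomial (Fin n) k ⧸ I) ω ∧
    ∃ d : ℕ, ringKrullDim (MvPolynomial (Fin n) k ⧸ I) = (d : WithBot (WithTop ℕ)) ∧
      letI : Module (MvPolynomial (Fin n) k) ω := Module.compHom ω (Ideal.Quotient.mk I)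
      Nonempty (ω ≃ₗ[MvPolynomial (Fin n) k]
        (extMod (MvPolynomial (Fin n) k) (MvPolynomial (Fin n) k ⧸ I)
          (MvPolynomial (Fin n) k) (n - d)))

/-- A `ℤ`-grading on a module `ω` over `R = k[x_1,…,x_n]/I` compatible with the standard
grading of `R`. -/
def IsCompatibleGrading (I : Ideal (MvPolynomial (Fin n) k)) (ω : Type) [AddCommGroup ω]
    [Module (MvPolynomial (Fin n) k ⧸ I) ω] [Module k ω] (gr : ℤ → Submodule k ω) : Prop :=
  DirectSum.IsInternal gr ∧
    ∀ (i : ℕ) (j : ℤ) (r : MvPolynomial (Fin n) k ⧸ I) (m : ω),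
      r ∈ quotGrade k I i → m ∈ gr j → r • m ∈ gr ((i : ℤ) + j)

/-- The minimal number of generators of a module `M` over `R = k[…]/I` with graded maximal
ideal `𝔪`: the `k`-dimension of `M/𝔪M`. -/
noncomputable def muGen (R : Type) [CommRing R] [Algebra k R] (𝔪 : Ideal R) (M : Type)
    [AddCommGroup M] [Module R M] : ℕ :=
  letI : Module k (M ⧸ (𝔪 • (⊤ : Submodule R M))) :=
    Module.compHom (M ⧸ (𝔪 • (⊤ : Submodule R M))) (algebraMap k R)
  Module.finrank k (M ⧸ (𝔪 • (⊤ : Submodule R M)))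

/-- The Hilbert--Samuel function `j ↦ dim_k M/𝔪^j M` of a module. -/
noncomputable def hilbSam (R : Type) [CommRing R] [Algebra k R] (𝔪 : Ideal R) (M : Type)
    [AddCommGroup M] [Module R M] (j : ℕ) : ℕ :=
  letI : Module k (M ⧸ ((𝔪 ^ j) • (⊤ : Submodule R M))) :=
    Module.compHom (M ⧸ ((𝔪 ^ j) • (⊤ : Submodule R M))) (algebraMap k R)
  Module.finrank k (M ⧸ ((𝔪 ^ j) • (⊤ : Submodule R M)))

/-- `M` is an Ulrich module with respect to `𝔪`: its minimal number of generators `μ(M)`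
equals its multiplicity `e(𝔪; M) = lim_j t!·dim_k(M/𝔪^j M)/j^t`, where `t = dim M`. -/
def IsUlrich (R : Type) [CommRing R] [Algebra k R] (𝔪 : Ideal R) (M : Type) [AddCommGroup M]
    [Module R M] : Prop :=
  ∃ t : ℕ, ringKrullDim (R ⧸ Module.annihilator R M) = (t : WithBot (WithTop ℕ)) ∧
    Filter.Tendsto
      (fun j : ℕ => ((t.factorial : ℝ) * (hilbSam k R 𝔪 M j : ℝ)) / (j : ℝ) ^ t)
      Filter.atTop (nhds ((muGen k R 𝔪 M : ℝ)))

end Graded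

section SR

variable (k : Type) [Field k] {n : ℕ}

/-- The Stanley--Reisner ideal of `Δ`: generated by the squarefree monomials supported on
non-faces of `Δ`. -/
noncomputable def srIdeal (Δ : SC n) : Ideal (MvPolynomial (Fin n) k) :=
  Ideal.span {m | ∃ σ : Finset (Fin n), σ ∉ Δ.faces ∧ m = ∏ i ∈ σ, MvPolynomial.X i}

/-- The Stanley--Reisner ring `k[Δ]`. -/
abbrev SRRing (Δ : SC n) : Type := MvPolynomial (Fin n) k ⧸ srIdeal k Δ

/-- The graded maximal ideal of `k[Δ]`. -/
noncomputable abbrev srMax (Δ : SC n) : Ideal (SRRing k Δ) := quotMax k (srIdeal k Δ)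

/-- The value at `j` of the Hilbert function of the (canonically graded) canonical module of
`k[Δ]`, as computed by Gräbe's theorem:
`dim_k [ω]_j = Σ_{a ∈ ℕ^n, |a| = j} dim_k H_{dim Δ}(Δ, cost_Δ(supp a); k)`. -/
noncomputable def canonicalHilbert (Δ : SC n) (j : ℕ) : ℕ :=
  ∑ a ∈ (Fintype.piFinset fun _ : Fin n => Finset.range (j + 1)).filter
      (fun a => ∑ i, a i = j),
    Module.finrank k
      (Δ.relHomology k (Finset.univ.filter fun i => a i ≠ 0) (Δ.faces.sup Finset.card - 1))

/-- A `ℤ`-grading `gr` on a module `ω` over `k[Δ]` is the canonical grading of the canonical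
module if it is a compatible grading, is supported in nonnegative degrees, and its Hilbert
function is the one given by Gräbe's theorem. -/
def IsCanonicallyGraded (Δ : SC n) (ω : Type) [AddCommGroup ω] [Module (SRRing k Δ) ω]
    [Module k ω] (gr : ℤ → Submodule k ω) : Prop :=
  IsCompatibleGrading k (srIdeal k Δ) ω gr ∧ (∀ j : ℤ, j < 0 → gr j = ⊥) ∧
    ∀ j : ℕ, Module.finrank k (gr (j : ℤ)) = canonicalHilbert k Δ j

/-- A `ℤ^n`-grading `grN` on a module `ω` over `k[Δ]` (supported in `ℕ^n`) is the canonical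
multigrading of the canonical module if it is an internal direct sum, is compatible with the
`ℤ^n`-grading of `k[Δ]`, and its multigraded Hilbert function is the one given by Gräbe's
theorem: `dim_k [ω]_a = dim_k H_{dim Δ}(Δ, cost_Δ(supp a); k)`. -/
def IsCanonicallyMultiGraded (Δ : SC n) (ω : Type) [AddCommGroup ω] [Module (SRRing k Δ) ω]
    [Module k ω] (grN : (Fin n → ℕ) → Submodule k ω) : Prop :=
  DirectSum.IsInternal grN ∧
    (∀ (a b : Fin n → ℕ) (r : SRRing k Δ) (m : ω),
      r ∈ quotMonomialGrade k (srIdeal k Δ) a → m ∈ grN b → r • m ∈ grN (a + b)) ∧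
    ∀ a : Fin n → ℕ, Module.finrank k (grN a) =
      Module.finrank k
        (Δ.relHomology k (Finset.univ.filter fun i => a i ≠ 0) (Δ.faces.sup Finset.card - 1))

end SR

/-- The chain map `C_•(Δ, cost_Δ τ) → C_•(Δ, cost_Δ σ)` (for `τ ⊆ σ`) induced by the
inclusion `cost_Δ τ ⊆ cost_Δ σ`: basis faces not containing `σ` are sent to `0`. -/
def SC.relChainMap {n : ℕ} (Δ : SC n) (R : Type) [CommRing R] (τ σ : Finset (Fin n)) (c : ℕ) :
    Δ.relChain R τ c →ₗ[R] Δ.relChain R σ c :=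
  Matrix.mulVecLin (fun (β : Δ.RFace σ c) (α : Δ.RFace τ c) => if α.1 = β.1 then (1 : R) else 0)

set_option synthInstance.maxHeartbeats 1000000 in
/-- `R = k[x_1,…,x_n]/I` is almost Gorenstein with respect to a canonical module `ω` with
(canonical) grading `gr`: writing `a = a_R` for the `a`-invariant (so `-a` is the least degree
of `ω`), there is an injective degree-zero `R`-linear map `φ : R → ω(-a)` whose cokernel is
zero or an Ulrich module. -/
def IsAlmostGorenstein (k : Type) [Field k] {n : ℕ} (I : Ideal (MvPolynomial (Fin n) k))
    (ω : Type) [AddCommGroup ω] [Module (MvPolynomial (Fin n) k ⧸ I) ω] [Module k ω]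
    (gr : ℤ → Submodule k ω) : Prop :=
  ∃ a : ℤ, (gr (-a) ≠ ⊥ ∧ ∀ j : ℤ, j < -a → gr j = ⊥) ∧
    ∃ φ : (MvPolynomial (Fin n) k ⧸ I) →ₗ[MvPolynomial (Fin n) k ⧸ I] ω,
      Function.Injective φ ∧
      (∀ (i : ℕ) (r : MvPolynomial (Fin n) k ⧸ I),
        r ∈ quotGrade k I i → φ r ∈ gr ((i : ℤ) - a)) ∧
      (Subsingleton (ω ⧸ LinearMap.range φ) ∨
        IsUlrich k (MvPolynomial (Fin n) k ⧸ I) (quotMax k I) (ω ⧸ LinearMap.range φ))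

/-! ## Signs and Koszul cochains -/

/-- The sign `(-1)^{#{w ∈ U, w < v}}`. -/
def sgx (R : Type) [CommRing R] {n : ℕ} (v : Fin n) (U : Finset (Fin n)) : R :=
  (-1 : R) ^ ((U.filter (fun w => w < v)).card)

theorem sgx_sq (R : Type) [CommRing R] {n : ℕ} (v : Fin n) (U : Finset (Fin n)) :
    sgx R v U * sgx R v U = 1 := by
  unfold sgx
  rw [← pow_add, ← two_mul, pow_mul]; simp

theorem sgx_anti_lt (R : Type) [CommRing R] {n : ℕ} {u v : Fin n} {U : Finset (Fin n)}
    (hu : u ∈ U) (huv : u < v) :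
    sgx R u U * sgx R v (U.erase u) = - (sgx R v U * sgx R u (U.erase v)) := by
  unfold sgx
  have h1 : (U.erase v).filter (fun w => w < u) = U.filter (fun w => w < u) := by
    ext w
    simp only [Finset.mem_filter, Finset.mem_erase]
    constructor
    · rintro ⟨⟨_, h⟩, h'⟩; exact ⟨h, h'⟩
    · rintro ⟨h, h'⟩; exact ⟨⟨(lt_trans h' huv).ne, h⟩, h'⟩
  have h2 : (U.erase u).filter (fun w => w < v) = (U.filter (fun w => w < v)).erase u := by
    ext w
    simp only [Finset.mem_filter, Finset.mem_erase]
    tauto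
  have h3 : u ∈ U.filter (fun w => w < v) := by simp [hu, huv]
  have h4 := Finset.card_erase_add_one h3
  rw [h1, h2, ← h4, pow_succ]
  ring

theorem sgx_anti (R : Type) [CommRing R] {n : ℕ} {u v : Fin n} {U : Finset (Fin n)}
    (hu : u ∈ U) (hv : v ∈ U) (huv : u ≠ v) :
    sgx R u U * sgx R v (U.erase u) = - (sgx R v U * sgx R u (U.erase v)) := by
  rcases lt_or_gt_of_ne huv with h | h
  · exact sgx_anti_lt R hu h
  · rw [sgx_anti_lt R hv h, neg_neg]

theorem sgx_anti' (R : Type) [CommRing R] {n : ℕ} {u v : Fin n} {U : Finset (Fin n)}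
    (hu : u ∈ U) (hv : v ∈ U) (huv : u ≠ v) :
    sgx R u (U.erase v) * sgx R v (U.erase u) = - (sgx R v U * sgx R u U) := by
  have h := sgx_anti R hu hv huv
  have h1 := sgx_sq R u U
  have h2 := sgx_sq R u (U.erase v)
  calc sgx R u (U.erase v) * sgx R v (U.erase u)
      = (sgx R u U * sgx R u U) * (sgx R u (U.erase v) * sgx R v (U.erase u)) := by
        rw [h1, one_mul]
    _ = sgx R u U * sgx R u (U.erase v) * (sgx R u U * sgx R v (U.erase u)) := by ring
    _ = - (sgx R u U * sgx R v U * (sgx R u (U.erase v) * sgx R u (U.erase v))) := by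
        rw [h]; ring
    _ = _ := by rw [h2]; ring

section Koszul

variable {A : Type} [CommRing A] {n : ℕ} (x : Fin n → A)
variable {M : Type} [AddCommGroup M] [Module A M]

/-- The Koszul differential on cochains. -/
def kd : (Finset (Fin n) → M) →ₗ[A] (Finset (Fin n) → M) where
  toFun z := fun U => ∑ v ∈ U, (sgx A v U * x v) • z (U.erase v)
  map_add' z w := by
    funext U
    simp [smul_add, Finset.sum_add_distrib]
  map_smul' a z := by
    funext U
    simp only [Pi.smul_apply, RingHom.id_apply, Finset.smul_sum]
    exact Finset.sum_congr rfl fun v _ => smul_comm _ _ _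

theorem kd_apply (z : Finset (Fin n) → M) (U : Finset (Fin n)) :
    kd x z U = ∑ v ∈ U, (sgx A v U * x v) • z (U.erase v) := rfl

theorem kd_congr {z w : Finset (Fin n) → M} {i : ℕ} (h : ∀ F : Finset (Fin n), F.card = i → z F = w F)
    (U : Finset (Fin n)) (hU : U.card = i + 1) : kd x z U = kd x w U := by
  rw [kd_apply, kd_apply]
  refine Finset.sum_congr rfl fun v hv => ?_
  rw [h _ (by rw [Finset.card_erase_of_mem hv, hU]; rfl)]

theorem kd_kd (z : Finset (Fin n) → M) (U : Finset (Fin n)) : kd x (kd x z) U = 0 := by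
  have h : kd x (kd x z) U = ∑ p ∈ U.offDiag,
      ((sgx A p.1 U * x p.1) * (sgx A p.2 (U.erase p.1) * x p.2)) •
        z ((U.erase p.1).erase p.2) := by
    rw [kd_apply]
    have : ∀ v ∈ U, (sgx A v U * x v) • kd x z (U.erase v) =
        ∑ u ∈ U.erase v, ((sgx A v U * x v) * (sgx A u (U.erase v) * x u)) •
        z ((U.erase v).erase u) := by
      intro v _
      rw [kd_apply, Finset.smul_sum]
      exact Finset.sum_congr rfl fun u _ => smul_smul _ _ _
    rw [Finset.sum_congr rfl this, Finset.sum_sigma']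
    refine Finset.sum_bij' (fun p _ => (p.1, p.2)) (fun p _ => ⟨p.1, p.2⟩) ?_ ?_ ?_ ?_ ?_
    · rintro ⟨a, b⟩ h
      simp only [Finset.mem_sigma, Finset.mem_erase] at h
      simp only [Finset.mem_offDiag]
      exact ⟨h.1, h.2.2, fun e => h.2.1 e.symm⟩
    · rintro ⟨a, b⟩ h
      simp only [Finset.mem_offDiag] at h
      simp only [Finset.mem_sigma, Finset.mem_erase]
      exact ⟨h.1, fun e => h.2.2 e.symm, h.2.1⟩
    · rintro ⟨a, b⟩ _; rfl
    · rintro ⟨a, b⟩ _; rfl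
    · rintro ⟨a, b⟩ _; rfl
  rw [h]
  refine Finset.sum_involution (fun p _ => (p.2, p.1)) ?_ ?_ ?_ ?_
  · rintro ⟨a, b⟩ h
    simp only [Finset.mem_offDiag] at h
    simp only
    rw [Finset.erase_right_comm (a := b), ← add_smul]
    have := sgx_anti A h.1 h.2.1 h.2.2
    have e : sgx A a U * x a * (sgx A b (U.erase a) * x b) +
        sgx A b U * x b * (sgx A a (U.erase b) * x a) = 0 := by
      linear_combination (x a * x b) * this
    rw [e, zero_smul]
  · rintro ⟨a, b⟩ h _ e
    simp only [Finset.mem_offDiag] at h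
    simp only [Prod.mk.injEq] at e
    exact h.2.2 e.2
  · rintro ⟨a, b⟩ h
    simp only [Finset.mem_offDiag] at h ⊢
    exact ⟨h.2.1, h.1, fun e => h.2.2 e.symm⟩
  · rintro ⟨a, b⟩ h; rfl

/-- Contraction. -/
def kio (A : Type) [CommRing A] {n : ℕ} {M : Type} [AddCommGroup M] [Module A M] (a : Fin n)
    (z : Finset (Fin n) → M) : Finset (Fin n) → M :=
  fun U => if a ∈ U then 0 else sgx A a (insert a U) • z (insert a U)

theorem kd_kio (a : Fin n) (z : Finset (Fin n) → M) (U : Finset (Fin n)) :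
    kd x (kio A a z) U + kio A a (kd x z) U = x a • z U := by
  by_cases ha : a ∈ U
  · have h1 : kio A a (kd x z) U = 0 := by simp [kio, ha]
    rw [h1, add_zero, kd_apply, Finset.sum_eq_single_of_mem a ha]
    · simp only [kio, Finset.notMem_erase, if_false, Finset.insert_erase ha]
      rw [smul_smul]
      congr 1
      linear_combination (x a) * sgx_sq A a U
    · intro b hb hba
      have : a ∈ U.erase b := Finset.mem_erase.mpr ⟨hba.symm, ha⟩
      simp [kio, this]
  · have h1 : kio A a (kd x z) U = x a • z U + ∑ v ∈ U,
        (sgx A a (insert a U) * (sgx A v (insert a U) * x v)) • z ((insert a U).erase v) := by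
      simp only [kio, ha, if_false]
      rw [kd_apply, Finset.sum_insert ha, smul_add, smul_smul, Finset.erase_insert ha,
        ← mul_assoc, sgx_sq, one_mul, Finset.smul_sum]
      congr 1
      exact Finset.sum_congr rfl fun v _ => smul_smul _ _ _
    rw [h1, kd_apply, add_left_comm, ← Finset.sum_add_distrib, Finset.sum_eq_zero, add_zero]
    intro v hv
    have hva : v ≠ a := fun e => ha (e ▸ hv)
    have h2 : a ∉ U.erase v := fun h => ha (Finset.mem_of_mem_erase h)
    have h3 : insert a (U.erase v) = (insert a U).erase v :=
      (Finset.erase_insert_of_ne hva.symm).symm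
    have h4 := sgx_anti' A (Finset.mem_insert_of_mem hv) (Finset.mem_insert_self a U) hva
    rw [Finset.erase_insert ha] at h4
    simp only [kio, h2, if_false]
    rw [h3, smul_smul, ← add_smul]
    have e : sgx A v U * x v * sgx A a ((insert a U).erase v) +
        sgx A a (insert a U) * (sgx A v (insert a U) * x v) = 0 := by
      linear_combination (x v) * h4
    rw [e, zero_smul]

/-- Elements of the ideal generated by `x` kill Koszul cohomology. -/
theorem kd_killed {y : A} (hy : y ∈ Ideal.span (Set.range x)) {i : ℕ} (z : Finset (Fin n) → M)
    (hz : ∀ F : Finset (Fin n), F.card = i + 1 → kd x z F = 0) :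
    ∃ b : Finset (Fin n) → M, ∀ F : Finset (Fin n), F.card = i → y • z F = kd x b F := by
  obtain ⟨c, rfl⟩ := (Ideal.mem_span_range_iff_exists_fun).1 hy
  refine ⟨∑ a, c a • kio A a z, fun F hF => ?_⟩
  rw [map_sum, Finset.sum_smul, Finset.sum_apply]
  refine Finset.sum_congr rfl fun a _ => ?_
  rw [map_smul, Pi.smul_apply, mul_smul, ← kd_kio x a z F]
  have : kio A a (kd x z) F = 0 := by
    unfold kio
    split_ifs with h
    · rfl
    · rw [hz _ (by rw [Finset.card_insert_of_notMem h, hF]), smul_zero]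
  rw [this, add_zero]

variable (M) in
/-- Vanishing of the `i`-th Koszul cohomology. -/
def KVan (i : ℕ) : Prop :=
  ∀ z : Finset (Fin n) → M, (∀ F : Finset (Fin n), F.card = i + 1 → kd x z F = 0) →
    ∃ b : Finset (Fin n) → M, ∀ F : Finset (Fin n), F.card = i → z F = kd x b F

variable (M) in
/-- The `i`-th Koszul cohomology is generated by any of its nonzero elements. -/
def KCyc (i : ℕ) : Prop :=
  ∀ z w : Finset (Fin n) → M, (∀ F : Finset (Fin n), F.card = i + 1 → kd x z F = 0) →
    (∀ F : Finset (Fin n), F.card = i + 1 → kd x w F = 0) →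
    (∃ b : Finset (Fin n) → M, ∀ F : Finset (Fin n), F.card = i → w F = kd x b F) ∨
    ∃ (a : A) (b : Finset (Fin n) → M), ∀ F : Finset (Fin n), F.card = i →
      z F = a • w F + kd x b F

variable {N : Type} [AddCommGroup N] [Module A N]

theorem kd_map (π : M →ₗ[A] N) (z : Finset (Fin n) → M) (F : Finset (Fin n)) :
    kd x (fun U => π (z U)) F = π (kd x z F) := by
  simp [kd_apply, map_sum]

/-- Lifting a coboundary modulo `y`. -/
theorem kd_lift (π : M →ₗ[A] N) (hs : Function.Surjective π) {y : A}
    (hk : ∀ m, π m = 0 → ∃ m', m = y • m') {i : ℕ} (u : Finset (Fin n) → M)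
    (b : Finset (Fin n) → N) (h : ∀ F : Finset (Fin n), F.card = i → π (u F) = kd x b F) :
    ∃ s t : Finset (Fin n) → M, ∀ F : Finset (Fin n), F.card = i → u F = kd x s F + y • t F := by
  choose g hg using hs
  have hb : b = fun U => π (g (b U)) := by funext U; rw [hg]
  have : ∀ F : Finset (Fin n), ∃ m, F.card = i → u F - kd x (fun U => g (b U)) F = y • m := by
    intro F
    by_cases hF : F.card = i
    · obtain ⟨m, hm⟩ := hk (u F - kd x (fun U => g (b U)) F) (by
        rw [map_sub, h F hF, ← kd_map, ← hb, sub_self])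
      exact ⟨m, fun _ => hm⟩
    · exact ⟨0, fun h => absurd h hF⟩
  choose t ht using this
  exact ⟨_, t, fun F hF => by rw [← ht F hF]; abel⟩

theorem kd_of_lift {y : A} (hreg : ∀ m : M, y • m = 0 → m = 0) {i : ℕ}
    {z u s t : Finset (Fin n) → M}
    (hzu : ∀ F : Finset (Fin n), F.card = i + 1 → y • z F = kd x u F)
    (h : ∀ F : Finset (Fin n), F.card = i → u F = kd x s F + y • t F) :
    ∀ F : Finset (Fin n), F.card = i + 1 → z F = kd x t F := by
  intro F hF
  have h1 : kd x u F = kd x (kd x s + y • t) F :=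
    kd_congr x (fun G hG => by rw [h G hG]; rfl) F hF
  rw [map_add, map_smul, Pi.add_apply, kd_kd, zero_add, ← hzu F hF, Pi.smul_apply] at h1
  exact sub_eq_zero.1 (hreg _ (by rw [smul_sub, h1, sub_self]))

theorem KVan.step (π : M →ₗ[A] N) (hs : Function.Surjective π) {y : A}
    (hy : y ∈ Ideal.span (Set.range x))
    (hk : ∀ m, π m = 0 → ∃ m', m = y • m') (hky : ∀ m, π (y • m) = 0)
    (hreg : ∀ m : M, y • m = 0 → m = 0) {i : ℕ} (h : KVan x N i) : KVan x M (i + 1) := by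
  intro z hz
  obtain ⟨u, hu⟩ := kd_killed x hy z hz
  obtain ⟨b, hb⟩ := h (fun U => π (u U)) (fun F hF => by rw [kd_map, ← hu F hF, hky])
  obtain ⟨s, t, hst⟩ := kd_lift x π hs hk u b hb
  exact ⟨t, kd_of_lift x hreg hu hst⟩

theorem KCyc.step (π : M →ₗ[A] N) (hs : Function.Surjective π) {y : A}
    (hy : y ∈ Ideal.span (Set.range x))
    (hk : ∀ m, π m = 0 → ∃ m', m = y • m') (hky : ∀ m, π (y • m) = 0)
    (hreg : ∀ m : M, y • m = 0 → m = 0) {i : ℕ} (h : KCyc x N i) : KCyc x M (i + 1) := by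
  intro z w hz hw
  obtain ⟨u, hu⟩ := kd_killed x hy z hz
  obtain ⟨u', hu'⟩ := kd_killed x hy w hw
  rcases h (fun U => π (u U)) (fun U => π (u' U)) (fun F hF => by rw [kd_map, ← hu F hF, hky])
    (fun F hF => by rw [kd_map, ← hu' F hF, hky]) with ⟨b, hb⟩ | ⟨a, b, hb⟩
  · obtain ⟨s, t, hst⟩ := kd_lift x π hs hk u' b hb
    exact Or.inl ⟨t, kd_of_lift x hreg hu' hst⟩
  · obtain ⟨s, t, hst⟩ := kd_lift x π hs hk (u - a • u') b (fun F hF => by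
      rw [Pi.sub_apply, Pi.smul_apply, map_sub, map_smul, hb F hF]; abel)
    refine Or.inr ⟨a, t, fun F hF => ?_⟩
    have := kd_of_lift x hreg (z := z - a • w) (u := u - a • u') (fun F hF => by
      rw [map_sub, map_smul, Pi.sub_apply, Pi.sub_apply, Pi.smul_apply, Pi.smul_apply, smul_sub,
        smul_comm, hu F hF, hu' F hF]) hst F hF
    rw [← this]
    simp

end Koszul


section ExtPart

variable {A : Type} [CommRing A]

/-- Vanishing of the `i`-th cohomology of `Hom(P, M)`. -/
def EVan (P : ChainComplex (ModuleCat.{0} A) ℕ) (M : Type) [AddCommGroup M] [Module A M]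
    (i : ℕ) : Prop :=
  ∀ f : P.X i →ₗ[A] M, f ∘ₗ (P.d (i + 1) i).hom = 0 →
    ∃ g : P.X (i - 1) →ₗ[A] M, f = g ∘ₗ (P.d i (i - 1)).hom

/-- The `i`-th cohomology of `Hom(P, M)` is generated by any of its nonzero elements. -/
def ECyc (P : ChainComplex (ModuleCat.{0} A) ℕ) (M : Type) [AddCommGroup M] [Module A M]
    (i : ℕ) : Prop :=
  ∀ f f' : P.X i →ₗ[A] M, f ∘ₗ (P.d (i + 1) i).hom = 0 → f' ∘ₗ (P.d (i + 1) i).hom = 0 →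
    (∃ g : P.X (i - 1) →ₗ[A] M, f' = g ∘ₗ (P.d i (i - 1)).hom) ∨
    ∃ (a : A) (g : P.X (i - 1) →ₗ[A] M), f = a • f' + g ∘ₗ (P.d i (i - 1)).hom

variable (P : ChainComplex (ModuleCat.{0} A) ℕ) {M : Type} [AddCommGroup M] [Module A M]
  {N : Type} [AddCommGroup N] [Module A N]

theorem lift_div {X : Type} [AddCommGroup X] [Module A X] (π : M →ₗ[A] N) {y : A}
    (hk : ∀ m, π m = 0 → ∃ m', m = y • m')
    (hreg : ∀ m : M, y • m = 0 → m = 0) (f : X →ₗ[A] M) (hf : π ∘ₗ f = 0) :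
    ∃ w : X →ₗ[A] M, f = y • w := by
  have h : ∀ u, ∃ m', f u = y • m' := fun u => hk _ (LinearMap.congr_fun hf u)
  choose w hw using h
  have inj : ∀ a b : M, y • a = y • b → a = b := fun a b e =>
    sub_eq_zero.1 (hreg _ (by rw [smul_sub, e, sub_self]))
  refine ⟨{ toFun := w, map_add' := fun a b => inj _ _ ?_, map_smul' := fun a b => inj _ _ ?_ }, ?_⟩
  · rw [← hw, map_add, smul_add, ← hw, ← hw]
  · rw [← hw, map_smul, RingHom.id_apply, smul_comm, ← hw]
  · ext u; exact hw u

theorem d_dd (i : ℕ) (g : P.X (i - 1) →ₗ[A] M) :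
    (g ∘ₗ (P.d i (i - 1)).hom) ∘ₗ (P.d (i + 1) i).hom = 0 := by
  rw [LinearMap.comp_assoc, ← ModuleCat.hom_comp, P.d_comp_d]; simp

theorem d_dd' (i : ℕ) (g : P.X i →ₗ[A] M) :
    (g ∘ₗ (P.d (i + 1) i).hom) ∘ₗ (P.d (i + 1 + 1) (i + 1)).hom = 0 := by
  rw [LinearMap.comp_assoc, ← ModuleCat.hom_comp, P.d_comp_d]; simp

theorem E_aux (π : M →ₗ[A] N) {y : A}
    (hky : ∀ m, π (y • m) = 0)
    {i : ℕ}
    (h0 : EVan P M i) (u : P.X i →ₗ[A] M) (t : P.X i →ₗ[A] M)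
    (h : u ∘ₗ (P.d (i + 1) i).hom = y • (t ∘ₗ (P.d (i + 1) i).hom)) :
    ∃ g : P.X (i - 1) →ₗ[A] N, π ∘ₗ u = g ∘ₗ (P.d i (i - 1)).hom := by
  obtain ⟨s, hs⟩ := h0 (u - y • t) (by
    rw [LinearMap.sub_comp, h, LinearMap.smul_comp, sub_self])
  refine ⟨π ∘ₗ s, ?_⟩
  rw [LinearMap.comp_assoc, ← hs]
  ext p
  simp [hky, map_sub, -map_smul]

theorem ECyc.step [∀ i, Module.Projective A (P.X i)] (π : M →ₗ[A] N)
    (hsur : Function.Surjective π) {y : A}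
    (hk : ∀ m, π m = 0 → ∃ m', m = y • m') (hky : ∀ m, π (y • m) = 0)
    (hreg : ∀ m : M, y • m = 0 → m = 0) {i : ℕ}
    (h0 : EVan P M i) (h1 : ECyc P M (i + 1)) : ECyc P N i := by
  intro f f' hf hf'
  obtain ⟨u, rfl⟩ := Module.projective_lifting_property π f hsur
  obtain ⟨u', rfl⟩ := Module.projective_lifting_property π f' hsur
  obtain ⟨w, hw⟩ := lift_div π hk hreg (u ∘ₗ (P.d (i + 1) i).hom) (by
    rw [← LinearMap.comp_assoc, hf])
  obtain ⟨w', hw'⟩ := lift_div π hk hreg (u' ∘ₗ (P.d (i + 1) i).hom) (by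
    rw [← LinearMap.comp_assoc, hf'])
  have key : ∀ (u w : _ →ₗ[A] M), u ∘ₗ (P.d (i + 1) i).hom = y • w →
      w ∘ₗ (P.d (i + 1 + 1) (i + 1)).hom = 0 := by
    intro u w hw
    ext p
    apply hreg
    have := LinearMap.congr_fun (d_dd' P i u) p
    rw [hw] at this
    simpa using this
  rcases h1 w w' (key u w hw) (key u' w' hw') with ⟨t, ht⟩ | ⟨a, t, ht⟩
  · left
    exact E_aux P π hky h0 u' t (by rw [hw', ht]; rfl)
  · right
    obtain ⟨g, hg⟩ := E_aux P π hky h0 (u - a • u') t (by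
      rw [LinearMap.sub_comp, LinearMap.smul_comp, hw, hw', ht]
      ext p
      simp [smul_comm a y])
    refine ⟨a, g, ?_⟩
    rw [← hg]
    ext p
    simp

theorem EVan.step [∀ i, Module.Projective A (P.X i)] (π : M →ₗ[A] N)
    (hsur : Function.Surjective π) {y : A}
    (hk : ∀ m, π m = 0 → ∃ m', m = y • m') (hky : ∀ m, π (y • m) = 0)
    (hreg : ∀ m : M, y • m = 0 → m = 0) {i : ℕ}
    (h0 : EVan P M i) (h1 : EVan P M (i + 1)) : EVan P N i := by
  intro f hf
  obtain ⟨u, rfl⟩ := Module.projective_lifting_property π f hsur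
  obtain ⟨w, hw⟩ := lift_div π hk hreg (u ∘ₗ (P.d (i + 1) i).hom) (by
    rw [← LinearMap.comp_assoc, hf])
  have key : w ∘ₗ (P.d (i + 1 + 1) (i + 1)).hom = 0 := by
    ext p
    apply hreg
    have := LinearMap.congr_fun (d_dd' P i u) p
    rw [hw] at this
    simpa using this
  obtain ⟨t, ht⟩ := h1 w key
  exact E_aux P π hky h0 u t (by rw [hw, ht]; rfl)

/-- From the vanishing of `Hom(κ, M)` we get a regular element. -/
theorem exists_reg [IsLocalRing A] [IsNoetherianRing A] [Module.Finite A M]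
    (h : ∀ m : M, (∀ a ∈ IsLocalRing.maximalIdeal A, a • m = 0) → m = 0) :
    ∃ y ∈ IsLocalRing.maximalIdeal A, ∀ m : M, y • m = 0 → m = 0 := by
  by_contra hcon
  push Not at hcon
  have hsub : (IsLocalRing.maximalIdeal A : Set A) ⊆ ⋃ p ∈ associatedPrimes A M, (id p : Ideal A) := by
    simp only [id]
    rw [biUnion_associatedPrimes_eq_zero_divisors A M]
    intro y hy
    obtain ⟨m, hm, hm0⟩ := hcon y hy
    exact ⟨m, hm0, hm⟩
  obtain ⟨p, hp, hle⟩ := (Ideal.subset_union_prime_finite (associatedPrimes.finite A M)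
    (f := id) 0 0 (fun _ h _ _ => h.isPrime)).1 hsub
  have hp' : IsAssociatedPrime p M := hp
  have hpp := hp'.isPrime
  obtain ⟨m, hm⟩ := (isAssociatedPrime_iff (I := p) (M := M)).1 hp' |>.2
  have : m = 0 := h m fun a ha => by
    have := hle ha
    rw [id, hm] at this
    simpa using Submodule.mem_colon_singleton.1 this
  apply hpp.ne_top
  rw [hm, this]
  simp

/-- Data of the augmentation of a resolution of `A / 𝔪`. -/
theorem koszul_of_ext [IsLocalRing A] [IsNoetherianRing A] [∀ i, Module.Projective A (P.X i)]
    (ε : P.X 0 →ₗ[A] (A ⧸ IsLocalRing.maximalIdeal A)) (hε : Function.Surjective ε)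
    (hεd : ε ∘ₗ (P.d 1 0).hom = 0) {n : ℕ} (x : Fin n → A)
    (hx : Ideal.span (Set.range x) = IsLocalRing.maximalIdeal A) (r : ℕ) :
    ∀ (M : Type) [AddCommGroup M] [Module A M] [Module.Finite A M],
      (∀ i < r, EVan P M i) → (EVan P M r → KVan x M r) ∧ (ECyc P M r → KCyc x M r) := by
  have hd0 : P.d 0 (0 - 1) = 0 := P.shape _ _ (by simp)
  -- elements killed by the maximal ideal
  have ev : ∀ (M : Type) [AddCommGroup M] [Module A M] (m : M),
      (∀ a ∈ IsLocalRing.maximalIdeal A, a • m = 0) → ∃ f : P.X 0 →ₗ[A] M,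
        f ∘ₗ (P.d (0 + 1) 0).hom = 0 ∧ ∀ p a, ε p = Ideal.Quotient.mk _ a → f p = a • m := by
    intro M _ _ m hm
    let φ : (A ⧸ IsLocalRing.maximalIdeal A) →ₗ[A] M :=
      Submodule.liftQ _ (LinearMap.toSpanSingleton A M m) (by
        intro a ha
        simpa using hm a ha)
    refine ⟨φ ∘ₗ ε, by rw [LinearMap.comp_assoc, hεd, LinearMap.comp_zero], fun p a hpa => ?_⟩
    rw [LinearMap.comp_apply, hpa]
    exact (Submodule.liftQ_apply _ _ _).trans (by simp)
  obtain ⟨p1, hp1⟩ := hε (Ideal.Quotient.mk _ 1)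
  have hvan : ∀ (M : Type) [AddCommGroup M] [Module A M], EVan P M 0 → ∀ m : M,
      (∀ a ∈ IsLocalRing.maximalIdeal A, a • m = 0) → m = 0 := by
    intro M _ _ h m hm
    obtain ⟨f, hf, hf'⟩ := ev M m hm
    obtain ⟨g, hg⟩ := h f hf
    rw [hd0] at hg
    have := hf' p1 1 hp1
    rw [hg] at this
    simpa using this.symm
  have hkill : ∀ (M : Type) [AddCommGroup M] [Module A M] (z : Finset (Fin n) → M),
      (∀ F : Finset (Fin n), F.card = 0 + 1 → kd x z F = 0) →
      ∀ a ∈ IsLocalRing.maximalIdeal A, a • z ∅ = 0 := by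
    intro M _ _ z hz a ha
    rw [← hx] at ha
    obtain ⟨c, rfl⟩ := (Ideal.mem_span_range_iff_exists_fun).1 ha
    rw [Finset.sum_smul]
    refine Finset.sum_eq_zero fun v _ => ?_
    have := hz {v} (by simp)
    rw [kd_apply] at this
    simp [sgx, Finset.filter_singleton] at this
    rw [mul_smul, this, smul_zero]
  induction r with
  | zero =>
    intro M _ _ _ _
    constructor
    · intro h z hz
      refine ⟨0, fun F hF => ?_⟩
      rw [Finset.card_eq_zero.1 hF, hvan M h _ (hkill M z hz)]
      simp
    · intro h z w hz hw
      obtain ⟨f, hf, hf'⟩ := ev M _ (hkill M z hz)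
      obtain ⟨g, hg, hg'⟩ := ev M _ (hkill M w hw)
      have e1 := hf' p1 1 hp1
      have e2 := hg' p1 1 hp1
      rw [one_smul] at e1 e2
      rcases h f g hf hg with ⟨t, ht⟩ | ⟨a, t, ht⟩
      · refine Or.inl ⟨0, fun F hF => ?_⟩
        rw [Finset.card_eq_zero.1 hF, ← e2, ht, hd0]
        simp
      · refine Or.inr ⟨a, 0, fun F hF => ?_⟩
        rw [Finset.card_eq_zero.1 hF, ← e2, ← e1, ht, hd0]
        simp
  | succ r ih =>
    intro M _ _ _ hM
    obtain ⟨y, hy, hreg⟩ := exists_reg (M := M) (hvan M (hM 0 (Nat.succ_pos r)))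
    let Y : Submodule A M := LinearMap.range (LinearMap.lsmul A M y)
    have hsur : Function.Surjective Y.mkQ := Submodule.mkQ_surjective _
    have hk : ∀ m, Y.mkQ m = 0 → ∃ m', m = y • m' := by
      intro m hm
      rw [Submodule.mkQ_apply, Submodule.Quotient.mk_eq_zero] at hm
      obtain ⟨m', h⟩ := hm
      exact ⟨m', h.symm⟩
    have hky : ∀ m, Y.mkQ (y • m) = 0 := by
      intro m
      rw [Submodule.mkQ_apply, Submodule.Quotient.mk_eq_zero]
      exact ⟨m, rfl⟩
    have hN : ∀ i < r, EVan P (M ⧸ Y) i := fun i hi =>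
      EVan.step P Y.mkQ hsur hk hky hreg (hM i (by omega)) (hM (i + 1) (by omega))
    obtain ⟨h1, h2⟩ := ih (M ⧸ Y) hN
    have hy' : y ∈ Ideal.span (Set.range x) := by rw [hx]; exact hy
    constructor
    · intro h
      exact KVan.step x Y.mkQ hsur hy' hk hky hreg
        (h1 (EVan.step P Y.mkQ hsur hk hky hreg (hM r (by omega)) h))
    · intro h
      exact KCyc.step x Y.mkQ hsur hy' hk hky hreg
        (h2 (ECyc.step P Y.mkQ hsur hk hky hreg (hM r (by omega)) h))

end ExtPart


section ExtLink

variable {A : Type} [CommRing A] {X Y : ModuleCat.{0} A} (P : ProjectiveResolution X)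

theorem evan_of_ext (i : ℕ) (M : Type) [AddCommGroup M] [Module A M]
    (h : Subsingleton (((Ext A (ModuleCat.{0} A) i).obj (Opposite.op X)).obj (ModuleCat.of A M))) :
    EVan P.complex M i := by
  have hz : Limits.IsZero ((P.complex.linearYonedaObj A (ModuleCat.of A M)).homology i) :=
    Limits.IsZero.of_iso (ModuleCat.isZero_of_subsingleton _) (P.isoExt i (ModuleCat.of A M)).symm
  rw [← HomologicalComplex.exactAt_iff_isZero_homology,
    HomologicalComplex.exactAt_iff' _ (i - 1) i (i + 1) (by cases i <;> simp) (by simp),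
    ShortComplex.moduleCat_exact_iff] at hz
  intro f hf
  have hc : P.complex.d (i + 1) i ≫ ModuleCat.ofHom f = 0 := by
    ext p
    exact LinearMap.congr_fun hf p
  obtain ⟨g, hg⟩ := hz (ModuleCat.ofHom f) hc
  let g' : P.complex.X (i - 1) ⟶ ModuleCat.of A M := g
  have hg' : P.complex.d i (i - 1) ≫ g' = ModuleCat.ofHom f := hg
  refine ⟨g'.hom, ?_⟩
  rw [← ModuleCat.hom_comp, hg']
  rfl

theorem ecyc_of_ext (i : ℕ) (M : Type) [AddCommGroup M] [Module A M] (𝔪 : Ideal A) [𝔪.IsMaximal]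
    (h : Nonempty ((((Ext A (ModuleCat.{0} A) i).obj (Opposite.op X)).obj (ModuleCat.of A M))
      ≃ₗ[A] (A ⧸ 𝔪))) :
    ECyc P.complex M i := by
  obtain ⟨e⟩ := h
  let S := (P.complex.linearYonedaObj A (ModuleCat.of A M)).sc' (i - 1) i (i + 1)
  let e1 : S.homology ≅ (P.complex.linearYonedaObj A (ModuleCat.of A M)).homology i :=
    (ShortComplex.homologyMapIso ((P.complex.linearYonedaObj A (ModuleCat.of A M)).isoSc'
      (i - 1) i (i + 1) (by cases i <;> simp) (by simp))).symm
  let e2 : S.moduleCatLeftHomologyData.H ≅ _ := S.moduleCatHomologyIso.symm ≪≫ e1 ≪≫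
    (P.isoExt i (ModuleCat.of A M)).symm
  let E : S.moduleCatLeftHomologyData.H ≃ₗ[A] (A ⧸ 𝔪) := e2.toLinearEquiv.trans e
  intro f f' hf hf'
  have hc : ∀ f : P.complex.X i →ₗ[A] M, f ∘ₗ (P.complex.d (i + 1) i).hom = 0 →
      S.g (ModuleCat.ofHom f) = 0 := by
    intro f hf
    have hc : P.complex.d (i + 1) i ≫ ModuleCat.ofHom f = 0 := by
      ext p
      exact LinearMap.congr_fun hf p
    exact hc
  let val : LinearMap.ker S.g.hom → (P.complex.X i ⟶ ModuleCat.of A M) := fun z => z.1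
  let c : LinearMap.ker S.g.hom := ⟨ModuleCat.ofHom f, hc f hf⟩
  let c' : LinearMap.ker S.g.hom := ⟨ModuleCat.ofHom f', hc f' hf'⟩
  let q : LinearMap.ker S.g.hom →ₗ[A] S.moduleCatLeftHomologyData.H :=
    S.moduleCatLeftHomologyData.π.hom
  have hq : ∀ z, q z = 0 → ∃ g : P.complex.X (i - 1) →ₗ[A] M,
      (val z).hom = g ∘ₗ (P.complex.d i (i - 1)).hom := by
    intro z hz
    have hz' : z ∈ LinearMap.range S.moduleCatToCycles := (Submodule.Quotient.mk_eq_zero _).1 hz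
    obtain ⟨g, hg⟩ := hz'
    let g' : P.complex.X (i - 1) ⟶ ModuleCat.of A M := g
    refine ⟨g'.hom, ?_⟩
    have hg' : P.complex.d i (i - 1) ≫ g' = val z := congrArg val hg
    rw [← ModuleCat.hom_comp, hg']
  by_cases h0 : E (q c') = 0
  · left
    exact hq c' ((LinearEquiv.map_eq_zero_iff E).1 h0)
  · right
    let _ := Ideal.Quotient.field 𝔪
    obtain ⟨a, ha⟩ := Ideal.Quotient.mk_surjective (E (q c) / E (q c'))
    obtain ⟨g, hg⟩ := hq (c - a • c') (by
      rw [← LinearEquiv.map_eq_zero_iff E, map_sub, map_smul, map_sub, map_smul, sub_eq_zero,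
        Algebra.smul_def]
      change _ = Ideal.Quotient.mk 𝔪 a * _
      rw [ha, div_mul_cancel₀ _ h0])
    refine ⟨a, g, ?_⟩
    rw [← hg]
    ext p
    change f p = a • f' p + (f p - a • f' p)
    abel

end ExtLink

/-- Koszul cohomology of a local ring satisfying the Gorenstein condition. -/
theorem koszul_of_gorenstein {A : Type} [CommRing A] [IsLocalRing A]
    (hG : IsGorensteinLocalRing A) (t : ℕ) (ht : (t : WithBot (WithTop ℕ)) ≤ ringKrullDim A)
    {n : ℕ} (x : Fin n → A)
    (hx : Ideal.span (Set.range x) = IsLocalRing.maximalIdeal A) :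
    (∀ i < t, KVan x A i) ∧ KCyc x A t := by
  obtain ⟨hN, hG⟩ := hG
  let X : ModuleCat.{0} A := ModuleCat.of A (A ⧸ IsLocalRing.maximalIdeal A)
  let P : ProjectiveResolution X := ProjectiveResolution.of X
  have hP : ∀ i, Module.Projective A (P.complex.X i) := fun i => by
    rw [IsProjective.iff_projective]
    exact P.projective i
  have hvan : ∀ i < t, EVan P.complex A i := fun i hi =>
    evan_of_ext P i A ((hG i).2 (ne_of_lt (lt_of_lt_of_le (by exact_mod_cast hi) ht)))
  have hcyc : ECyc P.complex A t := by
    by_cases h : (t : WithBot (WithTop ℕ)) = ringKrullDim A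
    · exact ecyc_of_ext P t A _ ((hG t).1 h)
    · have := evan_of_ext P t A ((hG t).2 h)
      intro f f' hf hf'
      exact Or.inl (this f' hf')
  let ε0 : P.complex.X 0 ⟶ X := P.π.f 0 ≫ (HomologicalComplex.singleObjXSelf _ 0 X).hom
  have hε0 : Epi ε0 := inferInstance
  have hd : P.complex.d 1 0 ≫ ε0 = 0 := by
    rw [← Category.assoc, P.complex_d_comp_π_f_zero, Limits.zero_comp]
  have key := fun r => koszul_of_ext P.complex ε0.hom
    ((ModuleCat.epi_iff_surjective ε0).1 hε0) (by
      rw [← ModuleCat.hom_comp, hd]; rfl) x hx r A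
  exact ⟨fun i hi => (key i (fun j hj => hvan j (by omega))).1 (hvan i hi),
    (key t hvan).2 hcyc⟩


section SRPart

variable (k : Type) [Field k] {n : ℕ}

/-- The retraction of the polynomial ring onto the polynomials in the variables of `σ`. -/
noncomputable def facePhi (σ : Finset (Fin n)) :
    MvPolynomial (Fin n) k →ₐ[k] MvPolynomial (Fin n) k :=
  MvPolynomial.aeval fun v => if v ∈ σ then MvPolynomial.X v else 0

theorem facePhi_monomial (σ : Finset (Fin n)) (u : Fin n →₀ ℕ) (a : k) :
    facePhi k σ (MvPolynomial.monomial u a) =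
      if u.support ⊆ σ then MvPolynomial.monomial u a else 0 := by
  rw [facePhi, MvPolynomial.aeval_monomial, MvPolynomial.algebraMap_eq]
  split_ifs with h
  · rw [MvPolynomial.monomial_eq]
    congr 1
    refine Finset.prod_congr rfl fun v hv => ?_
    simp only [if_pos (h hv)]
  · obtain ⟨v, hv, hvs⟩ := Finset.not_subset.1 h
    rw [Finsupp.prod, Finset.prod_eq_zero hv, mul_zero]
    simp only [if_neg hvs]
    exact zero_pow (Finsupp.mem_support_iff.1 hv)

theorem facePhi_coeff (σ : Finset (Fin n)) (p : MvPolynomial (Fin n) k) (m : Fin n →₀ ℕ) :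
    (facePhi k σ p).coeff m = if m.support ⊆ σ then p.coeff m else 0 := by
  induction p using MvPolynomial.induction_on' with
  | monomial u a =>
    rw [facePhi_monomial]
    by_cases hum : u = m
    · subst hum
      split_ifs <;> simp
    · split_ifs <;> simp [MvPolynomial.coeff_monomial, hum]
  | add p q hp hq =>
    rw [map_add, MvPolynomial.coeff_add, hp, hq, MvPolynomial.coeff_add]
    split_ifs <;> simp

/-- The exponent vector of a squarefree monomial. -/
noncomputable def indF (F : Finset (Fin n)) : Fin n →₀ ℕ := ∑ v ∈ F, Finsupp.single v 1

theorem prod_X_eq (F : Finset (Fin n)) :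
    (∏ v ∈ F, MvPolynomial.X v : MvPolynomial (Fin n) k) = MvPolynomial.monomial (indF F) 1 := by
  rw [indF, MvPolynomial.monomial_sum_one]
  rfl

theorem indF_apply (F : Finset (Fin n)) (v : Fin n) : indF F v = if v ∈ F then 1 else 0 := by
  simp [indF, Finsupp.finsetSum_apply, Finsupp.single_apply]

theorem indF_support (F : Finset (Fin n)) : (indF F).support = F := by
  ext v
  simp [indF_apply]

theorem indF_erase (F : Finset (Fin n)) {u : Fin n} (hu : u ∈ F) :
    indF F = Finsupp.single u 1 + indF (F.erase u) := by
  exact (Finset.add_sum_erase F (fun v => Finsupp.single v 1) hu).symm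

theorem srIdeal_coeff (Δ : SC n) {p : MvPolynomial (Fin n) k} (hp : p ∈ srIdeal k Δ) :
    ∀ m : Fin n →₀ ℕ, m.support ∈ Δ.faces → p.coeff m = 0 := by
  refine Submodule.span_induction (p := fun p _ => ∀ m : Fin n →₀ ℕ, m.support ∈ Δ.faces →
    p.coeff m = 0) ?_ ?_ ?_ ?_ hp
  · rintro p ⟨τ, hτ, rfl⟩ m hm
    rw [prod_X_eq, MvPolynomial.coeff_monomial, if_neg]
    rintro rfl
    rw [indF_support] at hm
    exact hτ hm
  · intro m _; simp
  · intro p q _ _ hp hq m hm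
    rw [MvPolynomial.coeff_add, hp m hm, hq m hm, add_zero]
  · intro a p _ hp m hm
    rw [smul_eq_mul, MvPolynomial.coeff_mul]
    refine Finset.sum_eq_zero fun x hx => ?_
    rw [Finset.HasAntidiagonal.mem_antidiagonal] at hx
    rw [hp x.2 (Δ.down_closed hm _), mul_zero]
    rw [← hx]
    intro v hv
    simp only [Finsupp.mem_support_iff, Finsupp.add_apply] at hv ⊢
    omega

theorem facePhi_sr (Δ : SC n) {σ : Finset (Fin n)} (hσ : σ ∈ Δ.faces) :
    ∀ p ∈ srIdeal k Δ, (facePhi k σ).toRingHom p = 0 := by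
  intro p hp
  ext m
  change (facePhi k σ p).coeff m = _
  rw [facePhi_coeff, MvPolynomial.coeff_zero]
  split_ifs with h
  · exact srIdeal_coeff k Δ hp m (Δ.down_closed hσ h)
  · rfl

/-- The prime of the Stanley--Reisner ring generated by the variables outside `σ`. -/
noncomputable def facePrime (Δ : SC n) {σ : Finset (Fin n)} (hσ : σ ∈ Δ.faces) :
    Ideal (SRRing k Δ) :=
  RingHom.ker (Ideal.Quotient.lift (srIdeal k Δ) (facePhi k σ).toRingHom (facePhi_sr k Δ hσ))

instance facePrime_isPrime (Δ : SC n) {σ : Finset (Fin n)} (hσ : σ ∈ Δ.faces) :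
    (facePrime k Δ hσ).IsPrime := RingHom.ker_isPrime _

theorem mk_mem_facePrime (Δ : SC n) {σ : Finset (Fin n)} (hσ : σ ∈ Δ.faces)
    (p : MvPolynomial (Fin n) k) :
    Ideal.Quotient.mk (srIdeal k Δ) p ∈ facePrime k Δ hσ ↔ facePhi k σ p = 0 := by
  rw [facePrime, RingHom.mem_ker, Ideal.Quotient.lift_mk]
  rfl

theorem facePrime_homog (Δ : SC n) {σ : Finset (Fin n)} (hσ : σ ∈ Δ.faces) :
    IsHomogIdeal k ((facePrime k Δ hσ).comap (Ideal.Quotient.mk (srIdeal k Δ))) := by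
  intro p hp d
  rw [Ideal.mem_comap, mk_mem_facePrime] at hp ⊢
  ext m
  have := congrArg (MvPolynomial.coeff m) hp
  rw [facePhi_coeff, MvPolynomial.coeff_zero] at this ⊢
  rw [MvPolynomial.coeff_homogeneousComponent]
  split_ifs at this ⊢ <;> first | rfl | exact this

theorem facePrime_ne (Δ : SC n) {σ : Finset (Fin n)} (hσ : σ ∈ Δ.faces) (hne : σ ≠ ∅) :
    facePrime k Δ hσ ≠ quotMax k (srIdeal k Δ) := by
  obtain ⟨v, hv⟩ := Finset.nonempty_iff_ne_empty.2 hne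
  intro h
  have h1 : Ideal.Quotient.mk (srIdeal k Δ) (MvPolynomial.X v) ∈ quotMax k (srIdeal k Δ) :=
    Ideal.subset_span ⟨v, rfl⟩
  rw [← h, mk_mem_facePrime, facePhi, MvPolynomial.aeval_X, if_pos hv] at h1
  exact MvPolynomial.X_ne_zero v h1

theorem facePrime_lt (Δ : SC n) {σ τ : Finset (Fin n)} (hσ : σ ∈ Δ.faces) (hτ : τ ∈ Δ.faces)
    (h : σ ⊂ τ) : facePrime k Δ hτ < facePrime k Δ hσ := by
  constructor
  · intro y hy
    obtain ⟨p, rfl⟩ := Ideal.Quotient.mk_surjective y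
    rw [mk_mem_facePrime] at hy ⊢
    ext m
    have := congrArg (MvPolynomial.coeff m) hy
    rw [facePhi_coeff, MvPolynomial.coeff_zero] at this ⊢
    split_ifs with h1
    · rwa [if_pos (h1.trans h.1)] at this
    · rfl
  · intro hle
    obtain ⟨v, hv, hvs⟩ := Finset.exists_of_ssubset h
    have h1 : Ideal.Quotient.mk (srIdeal k Δ) (MvPolynomial.X v) ∈ facePrime k Δ hσ := by
      rw [mk_mem_facePrime, facePhi, MvPolynomial.aeval_X, if_neg hvs]
    have h2 := hle h1
    rw [mk_mem_facePrime, facePhi, MvPolynomial.aeval_X, if_pos hv] at h2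
    exact MvPolynomial.X_ne_zero v h2

theorem facePrime_height (Δ : SC n) (t : ℕ) : ∀ {σ τ : Finset (Fin n)} (hσ : σ ∈ Δ.faces)
    (_ : τ ∈ Δ.faces) (_ : σ ⊆ τ) (_ : τ.card = σ.card + t),
    (t : ℕ∞) ≤ (facePrime k Δ hσ).height := by
  induction t with
  | zero => intros; simp
  | succ t ih =>
    intro σ τ hσ hτ hst hc
    obtain ⟨v, hv, hvs⟩ : ∃ v ∈ τ, v ∉ σ := by
      by_contra hcon
      push Not at hcon
      have := Finset.card_le_card (show τ ⊆ σ from hcon)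
      omega
    have hins : insert v σ ⊆ τ := Finset.insert_subset hv hst
    have hf : insert v σ ∈ Δ.faces := Δ.down_closed hτ hins
    have h1 := ih hf hτ hins (by rw [Finset.card_insert_of_notMem hvs]; omega)
    have h2 := facePrime_lt k Δ hσ hf (Finset.ssubset_insert hvs)
    have h3 : (facePrime k Δ hf).height + 1 ≤ (facePrime k Δ hσ).height :=
      Ideal.height_add_one_le_of_lt_of_isPrime h2
    refine le_trans ?_ h3
    push_cast
    gcongr

end SRPart


section Extract

variable (k : Type) [Field k] {n : ℕ}

/-- The variables outside `σ` (and zero for the variables in `σ`). -/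
noncomputable def varP (σ : Finset (Fin n)) (v : Fin n) : MvPolynomial (Fin n) k :=
  if v ∈ σ then 0 else MvPolynomial.X v

theorem prod_varP {σ F : Finset (Fin n)} (h : Disjoint F σ) :
    ∏ v ∈ F, varP k σ v = MvPolynomial.monomial (indF F) 1 := by
  rw [← prod_X_eq]
  refine Finset.prod_congr rfl fun v hv => ?_
  rw [varP, if_neg (Finset.disjoint_left.1 h hv)]

theorem coeff_varP_mul_eq_zero (σ : Finset (Fin n)) (v : Fin n) (m : Fin n →₀ ℕ)
    (h : v ∉ σ → m v = 0) (p : MvPolynomial (Fin n) k) :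
    (varP k σ v * p).coeff m = 0 := by
  unfold varP
  split_ifs with hv
  · simp
  · rw [MvPolynomial.coeff_X_mul', if_neg]
    simpa using h hv

/-- Extraction of a multigraded component, at the polynomial level. -/
theorem extract_poly (Δ : SC n) {σ : Finset (Fin n)} (U₁ U₂ : Finset (Fin n))
    (h12 : U₁ = U₂ ∨ ¬ U₁ ⊆ U₂) (c₁ c₂ : Finset (Fin n) → k) (i : ℕ)
    (q q' : MvPolynomial (Fin n) k) (w : Finset (Fin n) → MvPolynomial (Fin n) k)
    (hq : facePhi k σ q ≠ 0)
    (h : ∀ U : Finset (Fin n), U.card = i →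
      q * (if U₁ ⊆ U then MvPolynomial.C (c₁ U) * ∏ v ∈ U \ U₁, varP k σ v else 0) -
      (q' * (if U₂ ⊆ U then MvPolynomial.C (c₂ U) * ∏ v ∈ U \ U₂, varP k σ v else 0) +
        ∑ v ∈ U, MvPolynomial.C (sgx k v U) * (varP k σ v * w (U.erase v))) ∈ srIdeal k Δ) :
    ∃ (l : k) (b : Finset (Fin n) → k), (U₁ ≠ U₂ → l = 0) ∧
      ∀ U : Finset (Fin n), U₁ ⊆ U → U.card = i → Disjoint (U \ U₁) σ →
        (U \ U₁) ∪ σ ∈ Δ.faces →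
        c₁ U = l * c₂ U + ∑ u ∈ U \ U₁, sgx k u U * b (U.erase u) := by
  classical
  obtain ⟨b0, hb0⟩ : ∃ b0 : Fin n →₀ ℕ, (facePhi k σ q).coeff b0 ≠ 0 := by
    by_contra hcon
    push Not at hcon
    exact hq (MvPolynomial.ext _ _ fun m => by simpa using hcon m)
  rw [facePhi_coeff] at hb0
  have hs : b0.support ⊆ σ := by
    by_contra hcon
    rw [if_neg hcon] at hb0
    exact hb0 rfl
  rw [if_pos hs] at hb0
  -- multiply by the monomial of `σ`
  set μ : MvPolynomial (Fin n) k := MvPolynomial.monomial (indF σ) 1 with hμ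
  set β : Fin n →₀ ℕ := indF σ + b0 with hβ
  have hβ0 : ∀ v, v ∉ σ → β v = 0 := by
    intro v hv
    rw [hβ, Finsupp.add_apply, indF_apply, if_neg hv, zero_add]
    by_contra hne
    exact hv (hs (Finsupp.mem_support_iff.2 hne))
  have hβs : ∀ F : Finset (Fin n), (β + indF F).support ⊆ F ∪ σ := by
    intro F v hv
    rw [Finsupp.mem_support_iff, Finsupp.add_apply, indF_apply] at hv
    rw [Finset.mem_union]
    by_contra hcon
    push Not at hcon
    rw [hβ0 v hcon.2, if_neg hcon.1] at hv
    exact hv rfl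
  have hQ : (μ * q).coeff β = q.coeff b0 := by
    rw [hβ, hμ, MvPolynomial.coeff_monomial_mul, one_mul]
  refine ⟨if U₁ = U₂ then (μ * q').coeff β / q.coeff b0 else 0,
    fun V => (μ * w V).coeff (β + indF (V \ U₁)) / q.coeff b0, fun h => if_neg h, ?_⟩
  intro U hU hUc hdis hface
  have h0 := srIdeal_coeff k Δ (Ideal.mul_mem_left _ μ (h U hUc)) (β + indF (U \ U₁))
    (Δ.down_closed hface (hβs _))
  rw [if_pos hU, mul_sub, mul_add, MvPolynomial.coeff_sub, MvPolynomial.coeff_add, sub_eq_zero]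
    at h0
  have e1 : (μ * (q * (MvPolynomial.C (c₁ U) * ∏ v ∈ U \ U₁, varP k σ v))).coeff
      (β + indF (U \ U₁)) = c₁ U * q.coeff b0 := by
    rw [prod_varP k hdis, show μ * (q * (MvPolynomial.C (c₁ U) *
      MvPolynomial.monomial (indF (U \ U₁)) 1)) = MvPolynomial.C (c₁ U) *
        ((μ * q) * MvPolynomial.monomial (indF (U \ U₁)) 1) by ring,
      MvPolynomial.coeff_C_mul, MvPolynomial.coeff_mul_monomial, mul_one, hQ]
  have hm0 : ∀ v ∈ U₁, v ∉ σ → (β + indF (U \ U₁)) v = 0 := by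
    intro v hv hvs
    rw [Finsupp.add_apply, hβ0 v hvs, indF_apply, if_neg (by simp [hv])]
  have e2 : (μ * (q' * (if U₂ ⊆ U then MvPolynomial.C (c₂ U) * ∏ v ∈ U \ U₂, varP k σ v
      else 0))).coeff (β + indF (U \ U₁)) =
      (if U₁ = U₂ then (μ * q').coeff β else 0) * c₂ U := by
    rcases h12 with h12 | h12
    · subst h12
      rw [if_pos hU, if_pos rfl]
      rw [prod_varP k hdis, show μ * (q' * (MvPolynomial.C (c₂ U) *
        MvPolynomial.monomial (indF (U \ U₁)) 1)) = MvPolynomial.C (c₂ U) *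
          ((μ * q') * MvPolynomial.monomial (indF (U \ U₁)) 1) by ring,
        MvPolynomial.coeff_C_mul, MvPolynomial.coeff_mul_monomial, mul_one, mul_comm]
    · have hne : U₁ ≠ U₂ := fun e => h12 (by rw [e])
      rw [if_neg hne, zero_mul]
      split_ifs with h2
      · obtain ⟨v, hv1, hv2⟩ := Finset.not_subset.1 h12
        rw [← Finset.mul_prod_erase _ _ (Finset.mem_sdiff.2 ⟨hU hv1, hv2⟩),
          mul_left_comm (MvPolynomial.C _), mul_left_comm q', mul_left_comm μ]
        exact coeff_varP_mul_eq_zero k σ v _ (hm0 v hv1) _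
      · simp
  have e3 : (μ * ∑ v ∈ U, MvPolynomial.C (sgx k v U) * (varP k σ v * w (U.erase v))).coeff
      (β + indF (U \ U₁)) =
      ∑ u ∈ U \ U₁, sgx k u U * (μ * w (U.erase u)).coeff (β + indF ((U.erase u) \ U₁)) := by
    rw [Finset.mul_sum, MvPolynomial.coeff_sum]
    symm
    rw [← Finset.sum_subset (Finset.sdiff_subset (s := U) (t := U₁))]
    · refine Finset.sum_congr rfl fun u hu => ?_
      have hus : u ∉ σ := Finset.disjoint_left.1 hdis hu
      rw [mul_left_comm, MvPolynomial.coeff_C_mul, mul_left_comm, varP, if_neg hus,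
        indF_erase _ hu, add_left_comm, MvPolynomial.coeff_X_mul, Finset.erase_sdiff_comm]
    · intro v hv hv'
      have hv1 : v ∈ U₁ := by
        by_contra hcon
        exact hv' (Finset.mem_sdiff.2 ⟨hv, hcon⟩)
      rw [mul_left_comm, MvPolynomial.coeff_C_mul, mul_left_comm,
        coeff_varP_mul_eq_zero k σ v _ (hm0 v hv1), mul_zero]
  rw [e1, e2, e3] at h0
  rw [← mul_left_inj' hb0, h0, add_mul, Finset.sum_mul]
  congr 1
  · split_ifs
    · field_simp
    · simp
  · refine Finset.sum_congr rfl fun u _ => ?_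
    field_simp

section Gen

variable {k}

/-- The properties of the localization map at a face prime that are used below. -/
structure IsFaceLoc (Δ : SC n) (σ : Finset (Fin n)) {A : Type} [CommRing A]
    (θ : MvPolynomial (Fin n) k →+* A) : Prop where
  surj : ∀ f : Option (Finset (Fin n)) → A, ∃ (q : MvPolynomial (Fin n) k)
    (p : Option (Finset (Fin n)) → MvPolynomial (Fin n) k), facePhi k σ q ≠ 0 ∧
      ∀ i, θ q * f i = θ (p i)
  eq_zero : ∀ p, θ p = 0 → ∃ q, facePhi k σ q ≠ 0 ∧ q * p ∈ srIdeal k Δ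
  ker : ∀ p ∈ srIdeal k Δ, θ p = 0
  unit : IsUnit (θ (∏ v ∈ σ, MvPolynomial.X v))

variable {A : Type} [CommRing A] (θ : MvPolynomial (Fin n) k →+* A)

/-- The variables outside `σ` in the localization. -/
noncomputable def xF (σ : Finset (Fin n)) (v : Fin n) : A := θ (varP k σ v)

/-- The Koszul cochain of a simplicial cochain. -/
noncomputable def zF (σ : Finset (Fin n)) (U₁ : Finset (Fin n)) (c : Finset (Fin n) → k) :
    Finset (Fin n) → A :=
  fun U => θ
    (if U₁ ⊆ U then MvPolynomial.C (c U) * ∏ v ∈ U \ U₁, varP k σ v else 0)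

variable {Δ : SC n} {σ : Finset (Fin n)} {θ}

/-- The polynomial relation. -/
noncomputable def relP (σ : Finset (Fin n)) (U₁ U₂ : Finset (Fin n)) (c₁ c₂ : Finset (Fin n) → k)
    (q q' : MvPolynomial (Fin n) k) (w : Finset (Fin n) → MvPolynomial (Fin n) k)
    (U : Finset (Fin n)) : MvPolynomial (Fin n) k :=
  q * (if U₁ ⊆ U then MvPolynomial.C (c₁ U) * ∏ v ∈ U \ U₁, varP k σ v else 0) -
      (q' * (if U₂ ⊆ U then MvPolynomial.C (c₂ U) * ∏ v ∈ U \ U₂, varP k σ v else 0) +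
        ∑ v ∈ U, MvPolynomial.C (sgx k v U) * (varP k σ v * w (U.erase v)))

theorem map_sgx {B : Type} [CommRing B] (f : B →+* A) (v : Fin n) (U : Finset (Fin n)) :
    f (sgx B v U) = sgx A v U := by
  unfold sgx
  rw [map_pow, map_neg, map_one]

theorem theta_sgx (v : Fin n) (U : Finset (Fin n)) :
    θ (MvPolynomial.C (sgx k v U)) = sgx A v U :=
  map_sgx (θ.comp MvPolynomial.C) v U

theorem theta_relP (σ : Finset (Fin n)) (U₁ U₂ : Finset (Fin n)) (c₁ c₂ : Finset (Fin n) → k)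
    (q q' : MvPolynomial (Fin n) k) (w : Finset (Fin n) → MvPolynomial (Fin n) k)
    (a : A) (f : Finset (Fin n) → A) (ha : θ q * a = θ q') (hw : ∀ V, θ q * f V = θ (w V))
    (U : Finset (Fin n)) (h : zF θ σ U₁ c₁ U = a • zF θ σ U₂ c₂ U + kd (xF θ σ) f U) :
    θ (relP σ U₁ U₂ c₁ c₂ q q' w U) = 0 := by
  have h1 : θ (relP σ U₁ U₂ c₁ c₂ q q' w U) = θ q * zF θ σ U₁ c₁ U -
      (θ q' * zF θ σ U₂ c₂ U + ∑ v ∈ U, sgx A v U * (xF θ σ v * θ (w (U.erase v)))) := by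
    unfold relP zF xF
    rw [map_sub, map_add, map_mul, map_mul, map_sum]
    refine congrArg _ (congrArg _ (Finset.sum_congr rfl fun v _ => ?_))
    rw [map_mul, map_mul, theta_sgx]
  rw [h1, h, kd_apply, sub_eq_zero, mul_add, smul_eq_mul, ← mul_assoc, ha, Finset.mul_sum]
  refine congrArg _ (Finset.sum_congr rfl fun v _ => ?_)
  rw [← hw, smul_eq_mul]
  ring

theorem extract_loc (hθ : IsFaceLoc Δ σ θ) (U₁ U₂ : Finset (Fin n))
    (h12 : U₁ = U₂ ∨ ¬ U₁ ⊆ U₂) (c₁ c₂ : Finset (Fin n) → k) (i : ℕ)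
    (a : A) (w : Finset (Fin n) → A)
    (h : ∀ U : Finset (Fin n), U.card = i →
      zF θ σ U₁ c₁ U = a • zF θ σ U₂ c₂ U + kd (xF θ σ) w U) :
    ∃ (l : k) (b : Finset (Fin n) → k), (U₁ ≠ U₂ → l = 0) ∧
      ∀ U : Finset (Fin n), U₁ ⊆ U → U.card = i → Disjoint (U \ U₁) σ →
        (U \ U₁) ∪ σ ∈ Δ.faces →
        c₁ U = l * c₂ U + ∑ u ∈ U \ U₁, sgx k u U * b (U.erase u) := by
  obtain ⟨q, p, hq, hp⟩ := hθ.surj (fun o : Option (Finset (Fin n)) => o.elim a w)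
  obtain ⟨q', hq'⟩ : ∃ q', q' = p none := ⟨_, rfl⟩
  obtain ⟨w', hw'⟩ : ∃ w', w' = fun V => p (some V) := ⟨_, rfl⟩
  have hr : ∀ U : Finset (Fin n), ∃ g, facePhi k σ g ≠ 0 ∧
      (U.card = i → g * relP σ U₁ U₂ c₁ c₂ q q' w' U ∈ srIdeal k Δ) := by
    intro U
    by_cases hU : U.card = i
    · obtain ⟨g, hg, hg'⟩ := hθ.eq_zero _ (theta_relP σ U₁ U₂ c₁ c₂ q q' w' a w
        (by rw [hq']; exact hp none) (fun V => by rw [hw']; exact hp (some V)) U (h U hU))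
      exact ⟨g, hg, fun _ => hg'⟩
    · exact ⟨1, by rw [map_one]; exact one_ne_zero, fun h => absurd h hU⟩
  choose g hg hg' using hr
  obtain ⟨G, hGd⟩ : ∃ G, G = ∏ U, g U := ⟨_, rfl⟩
  have hG : facePhi k σ G ≠ 0 := by
    rw [hGd, map_prod]
    exact Finset.prod_ne_zero_iff.2 fun U _ => hg U
  refine extract_poly k Δ U₁ U₂ h12 c₁ c₂ i (G * q) (G * q') (fun V => G * w' V)
    (by rw [map_mul]; exact mul_ne_zero hG hq) ?_
  intro U hU
  have h1 : G * relP σ U₁ U₂ c₁ c₂ q q' w' U ∈ srIdeal k Δ := by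
    rw [hGd, ← Finset.mul_prod_erase _ _ (Finset.mem_univ U), mul_right_comm]
    exact Ideal.mul_mem_right _ _ (hg' U hU)
  rw [relP, mul_sub, mul_add, Finset.mul_sum, ← mul_assoc, ← mul_assoc] at h1
  simp only [mul_left_comm G] at h1
  exact h1

set_option maxHeartbeats 2000000 in
/-- The differential of the Koszul cochain of a simplicial cochain. -/
theorem kd_zF (hθ : IsFaceLoc Δ σ θ) (U₁ : Finset (Fin n)) (c : Finset (Fin n) → k) (U : Finset (Fin n))
    (hc : U₁ ⊆ U → Disjoint (U \ U₁) σ → (U \ U₁) ∪ σ ∈ Δ.faces →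
      ∑ u ∈ U \ U₁, sgx k u U * c (U.erase u) = 0) :
    kd (xF θ σ) (zF θ σ U₁ c) U = 0 := by
  have hsg : ∀ (v : Fin n) (U : Finset (Fin n)),
      θ (MvPolynomial.C (sgx k v U)) = sgx (A) v U := by
    intro v U
    simp [sgx]
  rw [kd_apply]
  by_cases hU : U₁ ⊆ U
  · have h1 : ∑ v ∈ U, (sgx (A) v U * xF θ σ v) • zF θ σ U₁ c (U.erase v) =
        θ (MvPolynomial.C (∑ u ∈ U \ U₁, sgx k u U * c (U.erase u)) *
          ∏ v ∈ U \ U₁, varP k σ v) := by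
      rw [map_sum, Finset.sum_mul, map_sum]
      symm
      rw [← Finset.sum_subset (Finset.sdiff_subset (s := U) (t := U₁))]
      · refine Finset.sum_congr rfl fun u hu => ?_
        have hu' := Finset.mem_sdiff.1 hu
        have hsub : U₁ ⊆ U.erase u := Finset.subset_erase.2 ⟨hU, hu'.2⟩
        rw [zF, if_pos hsub, ← hsg, xF, smul_eq_mul, ← map_mul, ← map_mul,
          ← Finset.mul_prod_erase _ _ hu, Finset.erase_sdiff_comm, map_mul MvPolynomial.C]
        congr 1
        ring
      · intro v hv hv'
        have hv1 : v ∈ U₁ := by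
          by_contra hcon
          exact hv' (Finset.mem_sdiff.2 ⟨hv, hcon⟩)
        rw [zF, if_neg (fun h => (Finset.mem_erase.1 (h hv1)).1 rfl), map_zero, smul_zero]
    rw [h1]
    by_cases hd : Disjoint (U \ U₁) σ
    · by_cases hf : (U \ U₁) ∪ σ ∈ Δ.faces
      · rw [hc hU hd hf]; simp
      · -- the monomial vanishes in the localization
        have hz : θ (∏ v ∈ U \ U₁, varP k σ v) = 0 := by
          have hu := hθ.unit
          rw [← hu.mul_left_eq_zero, ← map_mul]
          have e : (∏ v ∈ U \ U₁, varP k σ v) * ∏ v ∈ σ, MvPolynomial.X v =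
              ∏ v ∈ (U \ U₁) ∪ σ, MvPolynomial.X v := by
            rw [prod_varP k hd, ← prod_X_eq, Finset.prod_union hd]
          rw [e]
          exact hθ.ker _ (Ideal.subset_span ⟨_, hf, rfl⟩)
        rw [map_mul, hz, mul_zero]
    · obtain ⟨v, hv, hvs⟩ := Finset.not_disjoint_iff.1 hd
      rw [Finset.prod_eq_zero hv (by simp [varP, hvs]), mul_zero, map_zero]
  · refine Finset.sum_eq_zero fun v _ => ?_
    rw [zF, if_neg (fun h => hU (h.trans (Finset.erase_subset _ _))), map_zero, smul_zero]

end Gen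

variable (Δ : SC n) {σ : Finset (Fin n)} (hσ : σ ∈ Δ.faces)

/-- The localization at the prime of a face. -/
abbrev FLoc : Type := Localization.AtPrime (facePrime k Δ hσ)

/-- The canonical map to the localization. -/
noncomputable def thetaF : MvPolynomial (Fin n) k →+* FLoc k Δ hσ :=
  (algebraMap (SRRing k Δ) (FLoc k Δ hσ)).comp (Ideal.Quotient.mk (srIdeal k Δ))

theorem thetaF_eq_zero (p : MvPolynomial (Fin n) k) (h : thetaF k Δ hσ p = 0) :
    ∃ q, facePhi k σ q ≠ 0 ∧ q * p ∈ srIdeal k Δ := by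
  have h' : algebraMap (SRRing k Δ) (FLoc k Δ hσ) (Ideal.Quotient.mk _ p) = 0 := h
  rw [IsLocalization.map_eq_zero_iff (facePrime k Δ hσ).primeCompl] at h'
  obtain ⟨⟨m, hm⟩, hmp⟩ := h'
  obtain ⟨q, rfl⟩ := Ideal.Quotient.mk_surjective m
  refine ⟨q, fun h => hm ((mk_mem_facePrime k Δ hσ q).2 h), ?_⟩
  rw [← Ideal.Quotient.eq_zero_iff_mem, map_mul]
  exact hmp

theorem thetaF_surj {ι : Type} [Finite ι] (f : ι → FLoc k Δ hσ) :
    ∃ (q : MvPolynomial (Fin n) k) (p : ι → MvPolynomial (Fin n) k), facePhi k σ q ≠ 0 ∧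
      ∀ i, thetaF k Δ hσ q * f i = thetaF k Δ hσ (p i) := by
  obtain ⟨⟨m, hm⟩, hmf⟩ := IsLocalization.exist_integer_multiples_of_finite
    (facePrime k Δ hσ).primeCompl f
  obtain ⟨q, rfl⟩ := Ideal.Quotient.mk_surjective m
  have : ∀ i, ∃ p, thetaF k Δ hσ q * f i = thetaF k Δ hσ p := by
    intro i
    obtain ⟨y, hy⟩ := hmf i
    obtain ⟨p, rfl⟩ := Ideal.Quotient.mk_surjective y
    refine ⟨p, ?_⟩
    refine Eq.trans ?_ hy.symm
    rw [Algebra.smul_def]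
    rfl
  choose p hp using this
  exact ⟨q, p, fun h => hm ((mk_mem_facePrime k Δ hσ q).2 h), hp⟩

theorem thetaF_isFaceLoc : IsFaceLoc (A := FLoc k Δ hσ) Δ σ (thetaF k Δ hσ) where
  surj f := thetaF_surj k Δ hσ f
  eq_zero p h := thetaF_eq_zero k Δ hσ p h
  ker p hp := by
    change algebraMap (SRRing k Δ) (FLoc k Δ hσ) (Ideal.Quotient.mk _ _) = _
    rw [Ideal.Quotient.eq_zero_iff_mem.2 hp, map_zero]
  unit := by
    refine IsLocalization.map_units (FLoc k Δ hσ)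
      (⟨Ideal.Quotient.mk _ (∏ v ∈ σ, MvPolynomial.X v), fun h => ?_⟩ :
        (facePrime k Δ hσ).primeCompl)
    have h' := (mk_mem_facePrime k Δ hσ _).1 h
    rw [prod_X_eq, facePhi_monomial, indF_support, if_pos (Finset.Subset.refl σ)] at h'
    have := congrArg (MvPolynomial.coeff (indF σ)) h'
    simp at this

theorem span_xF : Ideal.span (Set.range (xF (A := FLoc k Δ hσ) (thetaF k Δ hσ) σ)) =
    IsLocalRing.maximalIdeal (FLoc k Δ hσ) := by
  rw [← Localization.AtPrime.map_eq_maximalIdeal]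
  have h1 : facePrime k Δ hσ =
      Ideal.span (Set.range fun v => Ideal.Quotient.mk (srIdeal k Δ) (varP k σ v)) := by
    apply le_antisymm
    · intro y hy
      obtain ⟨p, rfl⟩ := Ideal.Quotient.mk_surjective y
      rw [mk_mem_facePrime] at hy
      let J : Ideal (MvPolynomial (Fin n) k) := Ideal.span (Set.range (varP k σ))
      have hJ : (Ideal.Quotient.mkₐ k J).comp (facePhi k σ) = Ideal.Quotient.mkₐ k J := by
        apply MvPolynomial.algHom_ext
        intro v
        rw [AlgHom.comp_apply, facePhi, MvPolynomial.aeval_X]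
        split_ifs with hv
        · rfl
        · rw [map_zero]
          symm
          refine Ideal.Quotient.eq_zero_iff_mem.2 (Ideal.subset_span ⟨v, ?_⟩)
          rw [varP, if_neg hv]
      have hp : p ∈ J := by
        have := congrArg (fun f => f p) hJ
        simp only [AlgHom.comp_apply] at this
        rw [hy, map_zero] at this
        exact Ideal.Quotient.eq_zero_iff_mem.1 this.symm
      have := Ideal.mem_map_of_mem (Ideal.Quotient.mk (srIdeal k Δ)) hp
      rw [Ideal.map_span, ← Set.range_comp] at this
      exact this
    · rw [Ideal.span_le]
      rintro _ ⟨v, rfl⟩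
      change _ ∈ facePrime k Δ hσ
      rw [mk_mem_facePrime]
      unfold varP
      split_ifs with hv
      · simp
      · rw [facePhi, MvPolynomial.aeval_X, if_neg hv]
  have h2 := congrArg (Ideal.map (algebraMap (SRRing k Δ) (FLoc k Δ hσ))) h1
  rw [h2, Ideal.map_span, ← Set.range_comp]
  rfl

end Extract


section Comb

variable (k : Type) [Field k] {n : ℕ} (Δ : SC n)

/-- The support condition for relative cochains. -/
def FC (σ U₁ U : Finset (Fin n)) : Prop :=
  U₁ ⊆ U ∧ Disjoint (U \ U₁) σ ∧ (U \ U₁) ∪ σ ∈ Δ.faces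

/-- Relative cocycles. -/
def RC (σ U₁ : Finset (Fin n)) (i : ℕ) (c : Finset (Fin n) → k) : Prop :=
  ∀ U : Finset (Fin n), U.card = i + 1 → FC Δ σ U₁ U →
    ∑ u ∈ U \ U₁, sgx k u U * c (U.erase u) = 0

/-- Relative coboundaries. -/
def RB (σ U₁ : Finset (Fin n)) (i : ℕ) (c : Finset (Fin n) → k) : Prop :=
  ∃ b : Finset (Fin n) → k, ∀ U : Finset (Fin n), U.card = i → FC Δ σ U₁ U →
    c U = ∑ u ∈ U \ U₁, sgx k u U * b (U.erase u)

/-- Vanishing of the relative cohomology. -/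
def LVan (σ U₁ : Finset (Fin n)) (i : ℕ) : Prop :=
  ∀ c : Finset (Fin n) → k, RC k Δ σ U₁ i c → RB k Δ σ U₁ i c

variable {k Δ}

theorem FC_empty_iff {σ U : Finset (Fin n)} :
    FC Δ σ ∅ U ↔ Disjoint U σ ∧ U ∪ σ ∈ Δ.faces := by
  simp [FC]

variable {A : Type} [CommRing A] {θ : MvPolynomial (Fin n) k →+* A} {σ : Finset (Fin n)}

theorem zF_cocycle (hθ : IsFaceLoc Δ σ θ) {U₁ : Finset (Fin n)} {i : ℕ}
    {c : Finset (Fin n) → k} (hc : RC k Δ σ U₁ i c) (F : Finset (Fin n)) (hF : F.card = i + 1) :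
    kd (xF θ σ) (zF θ σ U₁ c) F = 0 :=
  kd_zF hθ U₁ c F fun h1 h2 h3 => hc F hF ⟨h1, h2, h3⟩

theorem RB_of_kd (hθ : IsFaceLoc Δ σ θ) {U₁ : Finset (Fin n)} {i : ℕ}
    {c : Finset (Fin n) → k} {w : Finset (Fin n) → A}
    (h : ∀ F : Finset (Fin n), F.card = i → zF θ σ U₁ c F = kd (xF θ σ) w F) :
    RB k Δ σ U₁ i c := by
  obtain ⟨l, b, -, hb⟩ := extract_loc hθ U₁ U₁ (Or.inl rfl) c 0 i 0 w
    (fun U hU => by rw [zero_smul, zero_add]; exact h U hU)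
  refine ⟨b, fun U hU hF => ?_⟩
  rw [hb U hF.1 hU hF.2.1 hF.2.2]
  simp

theorem LVan_of_KVan (hθ : IsFaceLoc Δ σ θ) {i : ℕ} (hK : KVan (xF θ σ) A i)
    (U₁ : Finset (Fin n)) : LVan k Δ σ U₁ i := by
  intro c hc
  obtain ⟨w, hw⟩ := hK _ (zF_cocycle hθ hc)
  exact RB_of_kd hθ hw

theorem cyc_same (hθ : IsFaceLoc Δ σ θ) {i : ℕ} (hK : KCyc (xF θ σ) A i)
    (U₁ : Finset (Fin n)) (c c' : Finset (Fin n) → k) (hc : RC k Δ σ U₁ i c)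
    (hc' : RC k Δ σ U₁ i c') : RB k Δ σ U₁ i c' ∨
      ∃ l : k, RB k Δ σ U₁ i (fun U => c U - l * c' U) := by
  rcases hK _ _ (zF_cocycle hθ hc) (zF_cocycle hθ hc') with ⟨w, hw⟩ | ⟨a, w, hw⟩
  · exact Or.inl (RB_of_kd hθ hw)
  · right
    obtain ⟨l, b, -, hb⟩ := extract_loc hθ U₁ U₁ (Or.inl rfl) c c' i a w hw
    refine ⟨l, b, fun U hU hF => ?_⟩
    beta_reduce
    rw [hb U hF.1 hU hF.2.1 hF.2.2]
    ring

theorem cyc_diff (hθ : IsFaceLoc Δ σ θ) {i : ℕ} (hK : KCyc (xF θ σ) A i)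
    (U₁ U₂ : Finset (Fin n)) (h12 : ¬ U₁ ⊆ U₂) (c c' : Finset (Fin n) → k)
    (hc : RC k Δ σ U₁ i c) (hc' : RC k Δ σ U₂ i c') :
    RB k Δ σ U₂ i c' ∨ RB k Δ σ U₁ i c := by
  rcases hK _ _ (zF_cocycle hθ hc) (zF_cocycle hθ hc') with ⟨w, hw⟩ | ⟨a, w, hw⟩
  · exact Or.inl (RB_of_kd hθ hw)
  · right
    obtain ⟨l, b, hl, hb⟩ := extract_loc hθ U₁ U₂ (Or.inr h12) c c' i a w hw
    refine ⟨b, fun U hU hF => ?_⟩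
    rw [hb U hF.1 hU hF.2.1 hF.2.2, hl (fun e => h12 (by rw [e])), zero_mul, zero_add]

theorem LVan_insert {v : Fin n} (hv : v ∉ σ) {s : ℕ} (h0 : LVan k Δ σ ∅ (s + 1))
    (h1 : LVan k Δ σ {v} (s + 1)) : LVan k Δ (insert v σ) ∅ s := by
  intro c hc
  -- the sign computation, used twice
  have key : ∀ (f : Finset (Fin n) → k) (U : Finset (Fin n)), v ∈ U →
      ∑ u ∈ U.erase v, sgx k u U * (sgx k v (U.erase u) * f ((U.erase u).erase v)) =
      -(sgx k v U * ∑ u ∈ U.erase v, sgx k u (U.erase v) * f ((U.erase v).erase u)) := by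
    intro f U hvU
    rw [Finset.mul_sum, ← Finset.sum_neg_distrib]
    refine Finset.sum_congr rfl fun u hu => ?_
    have hu' := Finset.mem_erase.1 hu
    rw [← mul_assoc, sgx_anti k hu'.2 hvU hu'.1, Finset.erase_right_comm]
    ring
  have hW : ∀ U : Finset (Fin n), v ∈ U → Disjoint U σ → U ∪ σ ∈ Δ.faces →
      FC Δ (insert v σ) ∅ (U.erase v) := by
    intro U hvU hd hf
    rw [FC_empty_iff]
    constructor
    · rw [Finset.disjoint_insert_right]
      exact ⟨Finset.notMem_erase _ _, Finset.disjoint_of_subset_left (Finset.erase_subset _ _) hd⟩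
    · refine Δ.down_closed hf ?_
      intro w hw
      simp only [Finset.mem_union, Finset.mem_erase, Finset.mem_insert] at hw ⊢
      rcases hw with h | h | h
      · exact Or.inl h.2
      · exact Or.inl (h ▸ hvU)
      · exact Or.inr h
  let c1 : Finset (Fin n) → k := fun F => if v ∈ F then sgx k v F * c (F.erase v) else 0
  obtain ⟨e, he⟩ := h0 c1 (by
    intro U hU hF
    rw [FC_empty_iff] at hF
    rw [Finset.sdiff_empty]
    by_cases hvU : v ∈ U
    · rw [← Finset.add_sum_erase _ _ hvU]
      have e1 : ∑ u ∈ U.erase v, sgx k u U * c1 (U.erase u) =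
          ∑ u ∈ U.erase v, sgx k u U * (sgx k v (U.erase u) * c ((U.erase u).erase v)) := by
        refine Finset.sum_congr rfl fun u hu => ?_
        simp only [c1]
        rw [if_pos (Finset.mem_erase.2 ⟨(Finset.mem_erase.1 hu).1.symm, hvU⟩)]
      rw [e1, key c U hvU]
      have h2 := hc (U.erase v) (by rw [Finset.card_erase_of_mem hvU, hU]; rfl)
        (hW U hvU hF.1 hF.2)
      rw [Finset.sdiff_empty] at h2
      rw [h2]
      simp [c1]
    · refine Finset.sum_eq_zero fun u _ => ?_
      simp only [c1]
      rw [if_neg (fun h => hvU (Finset.mem_of_mem_erase h)), mul_zero])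
  simp only [Finset.sdiff_empty, FC_empty_iff] at he
  obtain ⟨b, hb⟩ := h1 (fun U => sgx k v U * e (U.erase v)) (by
    intro U hU hF
    obtain ⟨hvU, hd, hf⟩ := hF
    rw [Finset.singleton_subset_iff] at hvU
    rw [Finset.sdiff_singleton_eq_erase] at hd hf ⊢
    rw [key e U hvU, ← he (U.erase v) (by rw [Finset.card_erase_of_mem hvU, hU]; rfl) ⟨hd, hf⟩]
    simp [c1])
  refine ⟨fun K => -(sgx k v (insert v K) * (b (insert v K) + e (insert v K))), ?_⟩
  intro H hH hF
  rw [FC_empty_iff, Finset.disjoint_insert_right] at hF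
  obtain ⟨⟨hvH, hd⟩, hf⟩ := hF
  rw [Finset.sdiff_empty]
  have hvF : v ∈ insert v H := Finset.mem_insert_self _ _
  have hcard : (insert v H).card = s + 1 := by rw [Finset.card_insert_of_notMem hvH, hH]
  have hd' : Disjoint (insert v H) σ := Finset.disjoint_insert_left.2 ⟨hv, hd⟩
  have hf' : insert v H ∪ σ ∈ Δ.faces := by
    rw [Finset.insert_union, ← Finset.union_insert]; exact hf
  have hE : (insert v H).erase v = H := Finset.erase_insert hvH
  have h2 := he _ hcard ⟨hd', hf'⟩
  have h3 := hb _ hcard ⟨Finset.singleton_subset_iff.2 hvF, by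
    rw [Finset.sdiff_singleton_eq_erase, hE]; exact hd, by
    rw [Finset.sdiff_singleton_eq_erase, hE]
    exact Δ.down_closed hf' (Finset.union_subset_union (Finset.subset_insert _ _) (le_refl σ))⟩
  simp only [c1] at h2
  rw [if_pos hvF, ← Finset.add_sum_erase _ _ hvF, hE] at h2
  rw [Finset.sdiff_singleton_eq_erase, hE] at h3
  beta_reduce at h3
  rw [hE] at h3
  rw [h3, ← Finset.sum_add_distrib] at h2
  have h4 : c H = sgx k v (insert v H) * (sgx k v (insert v H) * c H) := by
    rw [← mul_assoc, sgx_sq, one_mul]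
  rw [h4, h2, Finset.mul_sum]
  refine Finset.sum_congr rfl fun u hu => ?_
  have huv : u ≠ v := fun h => hvH (h ▸ hu)
  have h5 := sgx_anti' k (Finset.mem_insert_of_mem hu : u ∈ insert v H) hvF huv
  have h6 : (insert v H).erase u = insert v (H.erase u) :=
    Finset.erase_insert_of_ne huv.symm
  rw [hE, h6] at h5
  rw [h6]
  linear_combination (b (insert v (H.erase u)) + e (insert v (H.erase u))) * h5

/-- Nonvanishing of the top cohomology of links. -/
theorem not_LVan (d : ℕ)
    (hpure : ∀ σ ∈ Δ.faces, ∃ τ ∈ Δ.faces, σ ⊆ τ ∧ τ.card = d + 1)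
    (hridge : ∀ σ ∈ Δ.faces, σ.card = d → ∃ v w, v ≠ w ∧ v ∉ σ ∧ w ∉ σ ∧
      insert v σ ∈ Δ.faces ∧ insert w σ ∈ Δ.faces)
    (hK : ∀ σ ∈ Δ.faces, σ ≠ ∅ → ∀ t, σ.card + t = d + 1 →
      ∃ (A : Type) (_ : CommRing A) (θ : MvPolynomial (Fin n) k →+* A), IsFaceLoc Δ σ θ ∧
        (∀ i < t, KVan (xF θ σ) A i) ∧ KCyc (xF θ σ) A t) (t : ℕ) :
    ∀ σ ∈ Δ.faces, σ ≠ ∅ → σ.card + t = d + 1 → ¬ LVan k Δ σ ∅ t := by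
  induction t with
  | zero =>
    intro σ hσ hne hc h
    obtain ⟨b, hb⟩ := h (fun _ => 1) (by
      intro U hU hF
      exfalso
      rw [FC_empty_iff] at hF
      obtain ⟨τ, hτ, hsub, hτc⟩ := hpure _ hF.2
      have h1 := Finset.card_union_of_disjoint hF.1
      have h3 := Finset.card_le_card hsub
      omega)
    have := hb ∅ rfl (by rw [FC_empty_iff]; simpa using hσ)
    simp at this
  | succ s ih =>
    intro σ hσ hne hc h
    obtain ⟨v, w, hvw, hv, hw, hvf, hwf⟩ : ∃ v w, v ≠ w ∧ v ∉ σ ∧ w ∉ σ ∧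
        insert v σ ∈ Δ.faces ∧ insert w σ ∈ Δ.faces := by
      rcases Nat.eq_zero_or_pos s with hs | hs
      · exact hridge σ hσ (by omega)
      · obtain ⟨τ, hτ, hsub, hτc⟩ := hpure σ hσ
        have h1 := Finset.card_sdiff_add_card_eq_card hsub
        obtain ⟨v, hv, w, hw, hvw⟩ := Finset.one_lt_card.1 (show 1 < (τ \ σ).card by omega)
        rw [Finset.mem_sdiff] at hv hw
        exact ⟨v, w, hvw, hv.2, hw.2,
          Δ.down_closed hτ (Finset.insert_subset hv.1 hsub),
          Δ.down_closed hτ (Finset.insert_subset hw.1 hsub)⟩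
    have hone : ∀ v, v ∉ σ → insert v σ ∈ Δ.faces → ¬ LVan k Δ σ {v} (s + 1) := by
      intro v hv hvf h1
      refine ih (insert v σ) hvf (Finset.insert_ne_empty _ _) ?_ (LVan_insert hv h h1)
      rw [Finset.card_insert_of_notMem hv]
      omega
    have h1 := hone v hv hvf
    have h2 := hone w hw hwf
    unfold LVan at h1 h2
    push Not at h1 h2
    obtain ⟨c1, hc1, hn1⟩ := h1
    obtain ⟨c2, hc2, hn2⟩ := h2
    obtain ⟨A, _, θ, hθ, -, hcyc⟩ := hK σ hσ hne _ hc
    rcases cyc_diff hθ hcyc {v} {w} (by simpa using hvw) c1 c2 hc1 hc2 with h | h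
    · exact hn2 h
    · exact hn1 h

theorem pure_of_pseudomanifold (d : ℕ) (hd : Δ.dim = (d : ℤ)) (hpm : Δ.IsPseudomanifold) :
    ∀ σ ∈ Δ.faces, ∃ τ ∈ Δ.faces, σ ⊆ τ ∧ Δ.IsFacet τ ∧ τ.card = d + 1 := by
  have hsup : Δ.faces.sup Finset.card = d + 1 := by
    unfold SC.dim at hd; omega
  have hmax : ∀ τ ∈ Δ.faces, τ.card ≤ d + 1 := fun τ hτ => by
    rw [← hsup]; exact Finset.le_sup (f := Finset.card) hτ
  obtain ⟨τ₀, hτ₀, hτ₀c⟩ := Finset.exists_mem_eq_sup Δ.faces ⟨∅, Δ.empty_mem⟩ Finset.card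
  rw [hsup] at hτ₀c
  have hτ₀f : Δ.IsFacet τ₀ := ⟨hτ₀, fun τ hτ hs =>
    Finset.eq_of_subset_of_card_le hs (by rw [← hτ₀c]; exact hmax τ hτ)⟩
  have hfac : ∀ α, Δ.IsFacet α → α.card = d + 1 := by
    intro α hα
    have := hpm.1 α τ₀ hα hτ₀f
    clear hα
    induction this using Relation.ReflTransGen.head_induction_on with
    | refl => exact hτ₀c.symm
    | head hab hbc ih =>
      rename_i a b
      obtain ⟨ha, hb, hab⟩ := hab
      rw [hd] at hab
      by_cases hE : a = b
      · rw [hE]; exact ih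
      · have h1 : (a ∩ b).card < a.card := by
          refine Finset.card_lt_card (Finset.ssubset_iff_subset_ne.2
            ⟨Finset.inter_subset_left, fun h => hE ?_⟩)
          exact ha.2 b hb.1 (Finset.inter_eq_left.1 h)
        have := hmax a ha.1
        omega
  intro σ hσ
  obtain ⟨τ, hτ, hτm⟩ := Finset.exists_max_image (Δ.faces.filter fun τ => σ ⊆ τ) Finset.card
    ⟨σ, by simpa using hσ⟩
  rw [Finset.mem_filter] at hτ
  have hf : Δ.IsFacet τ := ⟨hτ.1, fun ρ hρ hs => Finset.eq_of_subset_of_card_le hs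
    (hτm ρ (Finset.mem_filter.2 ⟨hρ, hτ.2.trans hs⟩))⟩
  exact ⟨τ, hτ.1, hτ.2, hf, hfac τ hf⟩

theorem ridge_of_pseudomanifold (d : ℕ) (hd : Δ.dim = (d : ℤ)) (hpm : Δ.IsPseudomanifold) :
    ∀ σ ∈ Δ.faces, σ.card = d → ∃ v w, v ≠ w ∧ v ∉ σ ∧ w ∉ σ ∧
      insert v σ ∈ Δ.faces ∧ insert w σ ∈ Δ.faces := by
  intro σ hσ hc
  have h2 := hpm.2 σ hσ (by rw [hd, hc])
  obtain ⟨F, G, hFG, hS⟩ := Set.ncard_eq_two.1 h2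
  have hall : ∀ F, Δ.IsFacet F → σ ⊆ F → ∃ v, v ∉ σ ∧ F = insert v σ := by
    intro F hF hs
    obtain ⟨τ, hτ, hsub, -, hcard⟩ := pure_of_pseudomanifold d hd hpm F hF.1
    have hE := hF.2 τ hτ hsub
    rw [← hE] at hcard
    have h1 := Finset.card_sdiff_add_card_eq_card hs
    obtain ⟨v, hv⟩ := Finset.card_eq_one.1 (show (F \ σ).card = 1 by omega)
    have hvm : v ∈ F \ σ := by rw [hv]; exact Finset.mem_singleton_self v
    refine ⟨v, (Finset.mem_sdiff.1 hvm).2, ?_⟩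
    rw [← Finset.sdiff_union_of_subset hs, hv, Finset.singleton_union]
  have hF : F ∈ {τ : Finset (Fin n) | Δ.IsFacet τ ∧ σ ⊆ τ} := by rw [hS]; simp
  have hG : G ∈ {τ : Finset (Fin n) | Δ.IsFacet τ ∧ σ ⊆ τ} := by rw [hS]; simp
  obtain ⟨v, hv, hvF⟩ := hall F hF.1 hF.2
  obtain ⟨w, hw, hwG⟩ := hall G hG.1 hG.2
  exact ⟨v, w, fun h => hFG (by rw [hvF, hwG, h]), hv, hw, hvF ▸ hF.1.1, hwG ▸ hG.1.1⟩

end Comb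


section LinAlg

variable {k : Type} [Field k] {V : Type} [AddCommGroup V] [Module k V] [FiniteDimensional k V]

theorem finrank_quot_comap {K R : Submodule k V} (hRK : R ≤ K) :
    Module.finrank k (K ⧸ Submodule.comap K.subtype R) + Module.finrank k R =
      Module.finrank k K := by
  rw [← Submodule.finrank_quotient_add_finrank (Submodule.comap K.subtype R)]
  rw [LinearEquiv.finrank_eq (Submodule.comapSubtypeEquivOfLe hRK)]

theorem quot_subsingleton {K R : Submodule k V} (hRK : R ≤ K)
    (h : Module.finrank k K = Module.finrank k R) :
    Subsingleton (K ⧸ Submodule.comap K.subtype R) := by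
  have := finrank_quot_comap hRK
  exact Module.finrank_zero_iff.1 (show Module.finrank k (K ⧸ Submodule.comap K.subtype R) = 0
    by omega)

theorem quot_line {K R : Submodule k V} (hRK : R ≤ K)
    (h : Module.finrank k K = Module.finrank k R + 1) :
    Nonempty ((K ⧸ Submodule.comap K.subtype R) ≃ₗ[k] k) := by
  have := finrank_quot_comap hRK
  exact ⟨LinearEquiv.ofFinrankEq _ _ (by rw [Module.finrank_self]; omega)⟩

theorem finrank_line {K S : Submodule k V} (hSK : S ≤ K) {z : V} (hz : z ∈ K) (hzS : z ∉ S)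
    (h : ∀ f ∈ K, ∃ l : k, f - l • z ∈ S) :
    Module.finrank k K = Module.finrank k S + 1 := by
  have h1 : K = S ⊔ Submodule.span k {z} := by
    apply le_antisymm
    · intro f hf
      obtain ⟨l, hl⟩ := h f hf
      rw [Submodule.mem_sup]
      exact ⟨_, hl, l • z, Submodule.smul_mem _ _ (Submodule.mem_span_singleton_self z), by simp⟩
    · rw [sup_le_iff, Submodule.span_singleton_le_iff_mem]
      exact ⟨hSK, hz⟩
  have h2 : S ⊓ Submodule.span k {z} = ⊥ := by
    rw [eq_bot_iff]
    intro x hx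
    obtain ⟨hx1, hx2⟩ := Submodule.mem_inf.1 hx
    obtain ⟨a, rfl⟩ := Submodule.mem_span_singleton.1 hx2
    by_cases ha : a = 0
    · simp [ha]
    · exact absurd ((Submodule.smul_mem_iff _ ha).1 hx1) hzS
  have hz0 : z ≠ 0 := fun h => hzS (by rw [h]; exact S.zero_mem)
  have h3 := Submodule.finrank_sup_add_finrank_inf_eq S (Submodule.span k {z})
  rw [h2, finrank_bot, ← h1, finrank_span_singleton hz0] at h3
  exact h3

end LinAlg

section Hom

variable {k : Type} [Field k] {n : ℕ} (Γ : SC n)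

/-- Restriction of a cochain to the faces of given cardinality. -/
def resF (i : ℕ) (b : Finset (Fin n) → k) : Γ.RFace ∅ i → k := fun τ => b τ.1

theorem resF_surj (i : ℕ) (f : Γ.RFace ∅ i → k) : ∃ b, resF Γ i b = f := by
  classical
  refine ⟨fun U => if h : U ∈ Γ.faces ∧ ∅ ⊆ U ∧ U.card = i then f ⟨U, h⟩ else 0, ?_⟩
  funext τ
  exact dif_pos τ.2

/-- The coboundary map. -/
noncomputable def cobF (k : Type) [Field k] (i : ℕ) :
    (Γ.RFace ∅ i → k) →ₗ[k] (Γ.RFace ∅ (i + 1) → k) :=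
  (Γ.relBMat k ∅ i).transpose.mulVecLin

theorem cobF_resF (i : ℕ) (b : Finset (Fin n) → k) :
    cobF Γ k i (resF Γ i b) = resF Γ (i + 1) (kd (fun _ => (1 : k)) b) := by
  funext τ
  rw [cobF, Matrix.mulVecLin_apply, resF, kd_apply, Matrix.mulVec, dotProduct]
  simp only [Matrix.transpose_apply, SC.relBMat, Finset.sum_mul]
  rw [Finset.sum_comm]
  refine Finset.sum_congr rfl fun v hv => ?_
  have hm : τ.1.erase v ∈ Γ.faces ∧ ∅ ⊆ τ.1.erase v ∧ (τ.1.erase v).card = i :=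
    ⟨Γ.down_closed τ.2.1 (Finset.erase_subset _ _), Finset.empty_subset _, by
      rw [Finset.card_erase_of_mem hv, τ.2.2.2]; rfl⟩
  refine (Finset.sum_eq_single (⟨τ.1.erase v, hm⟩ : Γ.RFace ∅ i) ?_ ?_).trans ?_
  · intro ρ _ hρ
    rw [if_neg, zero_mul]
    rintro ⟨-, h⟩
    exact hρ (Subtype.ext h.symm)
  · intro h
    exact absurd (Finset.mem_univ _) h
  · rw [if_pos ⟨Finset.notMem_empty v, rfl⟩, mul_one, smul_eq_mul]
    rfl

theorem cobF_cobF (i : ℕ) (f : Γ.RFace ∅ i → k) : cobF Γ k (i + 1) (cobF Γ k i f) = 0 := by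
  obtain ⟨b, rfl⟩ := resF_surj Γ i f
  rw [cobF_resF, cobF_resF]
  funext τ
  exact kd_kd _ _ _

theorem bMat_mul (i : ℕ) : Γ.relBMat k ∅ i * Γ.relBMat k ∅ (i + 1) = 0 := by
  rw [← Matrix.transpose_inj, Matrix.transpose_mul, Matrix.transpose_zero]
  apply Matrix.toLin'.injective
  rw [map_zero]
  refine LinearMap.ext fun f => ?_
  have h := cobF_cobF Γ i f
  rw [Matrix.toLin'_mul_apply]
  exact h

theorem range_le_ker (i : ℕ) :
    LinearMap.range (Γ.relBoundary k ∅ (i + 1)) ≤ LinearMap.ker (Γ.relBoundary k ∅ i) := by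
  rintro _ ⟨f, rfl⟩
  rw [LinearMap.mem_ker, SC.relBoundary, SC.relBoundary, Matrix.mulVecLin_apply,
    Matrix.mulVecLin_apply, Matrix.mulVec_mulVec, bMat_mul, Matrix.zero_mulVec]

theorem finrank_range_bd (i : ℕ) : Module.finrank k (LinearMap.range (Γ.relBoundary k ∅ i)) =
    Module.finrank k (LinearMap.range (cobF Γ k i)) :=
  (Matrix.rank_transpose (Γ.relBMat k ∅ i)).symm

theorem finrank_ker_bd (i : ℕ) :
    Module.finrank k (LinearMap.ker (Γ.relBoundary k ∅ i)) +
      Module.finrank k (LinearMap.range (cobF Γ k i)) =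
    Module.finrank k (LinearMap.ker (cobF Γ k (i + 1))) +
      Module.finrank k (LinearMap.range (Γ.relBoundary k ∅ (i + 1))) := by
  have h1 := LinearMap.finrank_range_add_finrank_ker (Γ.relBoundary k ∅ i)
  have h2 := LinearMap.finrank_range_add_finrank_ker (cobF Γ k (i + 1))
  have h3 := finrank_range_bd (k := k) Γ i
  have h4 := finrank_range_bd (k := k) Γ (i + 1)
  have h5 : Module.finrank k (Γ.relChain k ∅ (i + 1)) =
    Module.finrank k (Γ.RFace ∅ (i + 1) → k) := rfl
  omega

theorem range_cob_le (i : ℕ) :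
    LinearMap.range (cobF Γ k i) ≤ LinearMap.ker (cobF Γ k (i + 1)) := by
  rintro _ ⟨f, rfl⟩
  exact cobF_cobF Γ i f

theorem hom_subsingleton (i : ℕ)
    (h : LinearMap.ker (cobF Γ k (i + 1)) ≤ LinearMap.range (cobF Γ k i)) :
    Subsingleton (Γ.reducedHomology k i) := by
  refine quot_subsingleton (range_le_ker Γ i) ?_
  have h1 := finrank_ker_bd (k := k) Γ i
  rw [le_antisymm h (range_cob_le Γ i)] at h1
  omega

theorem hom_line (i : ℕ) {z : Γ.RFace ∅ (i + 1) → k} (hz : cobF Γ k (i + 1) z = 0)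
    (hzS : z ∉ LinearMap.range (cobF Γ k i))
    (h : ∀ f, cobF Γ k (i + 1) f = 0 → ∃ l : k, f - l • z ∈ LinearMap.range (cobF Γ k i)) :
    Nonempty ((Γ.reducedHomology k i) ≃ₗ[k] k) := by
  refine quot_line (range_le_ker Γ i) ?_
  have h1 := finrank_ker_bd (k := k) Γ i
  have h2 := finrank_line (range_cob_le Γ i) (LinearMap.mem_ker.2 hz) hzS
    (fun f hf => h f (LinearMap.mem_ker.1 hf))
  omega

theorem finrank_top_neg :
    Module.finrank k (⊤ : Submodule k (Γ.relChain k ∅ 0)) =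
      Module.finrank k (LinearMap.range (Γ.relBoundary k ∅ 0)) +
      Module.finrank k (LinearMap.ker (cobF Γ k 0)) := by
  have h2 := LinearMap.finrank_range_add_finrank_ker (cobF Γ k 0)
  rw [finrank_top, ← h2, finrank_range_bd]

theorem neg_subsingleton (h : ∀ f, cobF Γ k 0 f = 0 → f = 0) :
    Subsingleton (Γ.reducedHomologyNeg k) := by
  refine quot_subsingleton (K := ⊤) (R := LinearMap.range (Γ.relBoundary k ∅ 0)) le_top ?_
  rw [finrank_top_neg, LinearMap.ker_eq_bot'.2 h, finrank_bot, add_zero]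

theorem neg_line {z : Γ.RFace ∅ 0 → k} (hz : cobF Γ k 0 z = 0) (hz0 : z ≠ 0)
    (h : ∀ f, cobF Γ k 0 f = 0 → ∃ l : k, f - l • z = 0) :
    Nonempty ((Γ.reducedHomologyNeg k) ≃ₗ[k] k) := by
  refine quot_line (K := ⊤) (R := LinearMap.range (Γ.relBoundary k ∅ 0)) le_top ?_
  have h2 := finrank_line (S := ⊥) (K := LinearMap.ker (cobF Γ k 0)) bot_le
    (LinearMap.mem_ker.2 hz) (by simpa using hz0)
    (fun f hf => by simpa using h f (LinearMap.mem_ker.1 hf))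
  rw [finrank_bot] at h2
  rw [finrank_top_neg, h2]

end Hom

section Final

variable {k : Type} [Field k] {n : ℕ} {Δ : SC n} {σ : Finset (Fin n)} (hσ : σ ∈ Δ.faces)

theorem mem_link_iff {U : Finset (Fin n)} : U ∈ (Δ.link σ hσ).faces ↔ FC Δ σ ∅ U := by
  rw [FC_empty_iff]
  simp only [SC.link, Finset.mem_filter, Finset.disjoint_iff_inter_eq_empty]
  exact ⟨fun h => h.2, fun h => ⟨Δ.down_closed h.2 Finset.subset_union_left, h⟩⟩

theorem RC_iff (i : ℕ) (b : Finset (Fin n) → k) :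
    RC k Δ σ ∅ i b ↔ cobF (Δ.link σ hσ) k i (resF (Δ.link σ hσ) i b) = 0 := by
  rw [cobF_resF]
  constructor
  · intro h
    funext τ
    have := h τ.1 τ.2.2.2 ((mem_link_iff hσ).1 τ.2.1)
    rw [Finset.sdiff_empty] at this
    simpa [resF, kd_apply] using this
  · intro h U hU hF
    have := congrFun h ⟨U, (mem_link_iff hσ).2 hF, Finset.empty_subset _, hU⟩
    rw [Finset.sdiff_empty]
    simp only [resF, kd_apply, mul_one, smul_eq_mul] at this
    exact this

theorem RB_succ_iff (i : ℕ) (c : Finset (Fin n) → k) :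
    RB k Δ σ ∅ (i + 1) c ↔
      resF (Δ.link σ hσ) (i + 1) c ∈ LinearMap.range (cobF (Δ.link σ hσ) k i) := by
  constructor
  · rintro ⟨b, hb⟩
    refine ⟨resF _ i b, ?_⟩
    rw [cobF_resF]
    funext τ
    have := hb τ.1 τ.2.2.2 ((mem_link_iff hσ).1 τ.2.1)
    rw [Finset.sdiff_empty] at this
    simpa [resF, kd_apply] using this.symm
  · rintro ⟨f, hf⟩
    obtain ⟨b, rfl⟩ := resF_surj _ i f
    rw [cobF_resF] at hf
    refine ⟨b, fun U hU hF => ?_⟩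
    have := congrFun hf ⟨U, (mem_link_iff hσ).2 hF, Finset.empty_subset _, hU⟩
    rw [Finset.sdiff_empty]
    simpa [resF, kd_apply] using this.symm

theorem RB_zero_iff (c : Finset (Fin n) → k) :
    RB k Δ σ ∅ 0 c ↔ resF (Δ.link σ hσ) 0 c = 0 := by
  constructor
  · rintro ⟨b, hb⟩
    funext τ
    have := hb τ.1 τ.2.2.2 ((mem_link_iff hσ).1 τ.2.1)
    rw [Finset.card_eq_zero.1 τ.2.2.2] at this
    simpa [resF, Finset.card_eq_zero.1 τ.2.2.2] using this
  · intro h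
    refine ⟨0, fun U hU hF => ?_⟩
    have := congrFun h ⟨U, (mem_link_iff hσ).2 hF, Finset.empty_subset _, hU⟩
    obtain rfl := Finset.card_eq_zero.1 hU
    rw [Finset.empty_sdiff, Finset.sum_empty]
    exact this

theorem sphereCond (t : ℕ) (hdim : (Δ.link σ hσ).dim = (t : ℤ) - 1)
    (hvan : ∀ i, i ≠ t → LVan k Δ σ ∅ i) (hnot : ¬ LVan k Δ σ ∅ t)
    (hcyc : ∀ c c' : Finset (Fin n) → k, RC k Δ σ ∅ t c → RC k Δ σ ∅ t c' →
      RB k Δ σ ∅ t c' ∨ ∃ l : k, RB k Δ σ ∅ t (fun U => c U - l * c' U)) :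
    SC.HomologySphereCond k (Δ.link σ hσ) := by
  unfold LVan at hnot
  push Not at hnot
  obtain ⟨z, hz, hzB⟩ := hnot
  have hcyc' : ∀ c, RC k Δ σ ∅ t c → ∃ l : k, RB k Δ σ ∅ t (fun U => c U - l * z U) :=
    fun c hc => (hcyc c z hc hz).resolve_left hzB
  refine ⟨fun i => ⟨fun hi => ?_, fun hi => ?_⟩, fun hi => ?_, fun hi => ?_⟩
  · obtain rfl : t = i + 1 := by omega
    refine hom_line _ i (z := resF _ (i + 1) z) ((RC_iff hσ _ _).1 hz)
      (fun h => hzB ((RB_succ_iff hσ i z).2 h)) fun f hf => ?_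
    obtain ⟨c, rfl⟩ := resF_surj _ _ f
    obtain ⟨l, hl⟩ := hcyc' c ((RC_iff hσ _ _).2 hf)
    exact ⟨l, (RB_succ_iff hσ i _).1 hl⟩
  · refine hom_subsingleton _ i fun f hf => ?_
    obtain ⟨c, rfl⟩ := resF_surj _ _ f
    exact (RB_succ_iff hσ i c).1 (hvan (i + 1) (by omega) c ((RC_iff hσ _ _).2 hf))
  · obtain rfl : t = 0 := by omega
    refine neg_line _ (z := resF _ 0 z) ((RC_iff hσ _ _).1 hz)
      (fun h => hzB ((RB_zero_iff hσ z).2 h)) fun f hf => ?_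
    obtain ⟨c, rfl⟩ := resF_surj _ _ f
    obtain ⟨l, hl⟩ := hcyc' c ((RC_iff hσ _ _).2 hf)
    exact ⟨l, (RB_zero_iff hσ _).1 hl⟩
  · refine neg_subsingleton _ fun f hf => ?_
    obtain ⟨c, rfl⟩ := resF_surj _ _ f
    exact (RB_zero_iff hσ c).1 (hvan 0 (by omega) c ((RC_iff hσ _ _).2 hf))

theorem koszul_face (hGP : GorensteinPunctured k (srIdeal k Δ)) (d : ℕ)
    (hpure : ∀ σ ∈ Δ.faces, ∃ τ ∈ Δ.faces, σ ⊆ τ ∧ τ.card = d + 1)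
    (σ : Finset (Fin n)) (hσ : σ ∈ Δ.faces) (hne : σ ≠ ∅) (t : ℕ) (ht : σ.card + t = d + 1) :
      ∃ (A : Type) (_ : CommRing A) (θ : MvPolynomial (Fin n) k →+* A), IsFaceLoc Δ σ θ ∧
        (∀ i < t, KVan (xF θ σ) A i) ∧ KCyc (xF θ σ) A t := by
  have hG : IsGorensteinLocalRing (FLoc k Δ hσ) :=
    hGP (facePrime k Δ hσ) (facePrime_homog k Δ hσ) (facePrime_ne k Δ hσ hne)
  refine ⟨FLoc k Δ hσ, inferInstance, thetaF k Δ hσ, thetaF_isFaceLoc k Δ hσ, ?_⟩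
  refine koszul_of_gorenstein hG t ?_ _ (span_xF k Δ hσ)
  obtain ⟨τ, hτ, hsub, hτc⟩ := hpure σ hσ
  have h1 := facePrime_height k Δ t hσ hτ hsub (by omega)
  rw [IsLocalization.AtPrime.ringKrullDim_eq_height (facePrime k Δ hσ) (FLoc k Δ hσ)]
  exact WithBot.coe_le_coe.2 h1

end Final

theorem pm_main
    (k : Type) [Field k] {n : ℕ} (Δ : SC n) (d : ℕ) (hd : Δ.dim = (d : ℤ))
    (hconn : Δ.Connected) (hGP : GorensteinPunctured k (srIdeal k Δ))
    (hpm : Δ.IsPseudomanifold) :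
    Δ.IsHomologyManifold k := by
  have hpure : ∀ σ ∈ Δ.faces, ∃ τ ∈ Δ.faces, σ ⊆ τ ∧ τ.card = d + 1 := fun σ hσ => by
    obtain ⟨τ, h1, h2, -, h3⟩ := pure_of_pseudomanifold d hd hpm σ hσ
    exact ⟨τ, h1, h2, h3⟩
  have hK := koszul_face hGP d hpure
  have hmax : ∀ τ ∈ Δ.faces, τ.card ≤ d + 1 := fun τ hτ => by
    obtain ⟨ρ, -, h2, h3⟩ := hpure τ hτ
    rw [← h3]
    exact Finset.card_le_card h2
  refine ⟨hconn, fun σ hσ hne => ?_⟩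
  obtain ⟨t, ht⟩ := Nat.exists_eq_add_of_le (hmax σ hσ)
  have hcardF : ∀ U, FC Δ σ ∅ U → U.card ≤ t := by
    intro U hU
    rw [FC_empty_iff] at hU
    have h1 := Finset.card_union_of_disjoint hU.1
    have h2 := hmax _ hU.2
    omega
  have hsup : (Δ.link σ hσ).faces.sup Finset.card = t := by
    apply le_antisymm
    · exact Finset.sup_le fun U hU => hcardF U ((mem_link_iff hσ).1 hU)
    · obtain ⟨τ, hτ, hsub, hτc⟩ := hpure σ hσ
      have h1 := Finset.card_sdiff_add_card_eq_card hsub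
      have h2 : τ \ σ ∈ (Δ.link σ hσ).faces := by
        rw [mem_link_iff, FC_empty_iff]
        refine ⟨Finset.sdiff_disjoint, ?_⟩
        rw [Finset.sdiff_union_of_subset hsub]
        exact hτ
      have h3 := Finset.le_sup (f := Finset.card) h2
      omega
  obtain ⟨A, _, θ, hθ, hvan, hcyc⟩ := hK σ hσ hne t ht.symm
  refine sphereCond hσ t (by rw [SC.dim, hsup]) ?_
    (not_LVan d hpure (ridge_of_pseudomanifold d hd hpm) hK t σ hσ hne ht.symm)
    (fun c c' hc hc' => cyc_same hθ hcyc ∅ c c' hc hc')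
  intro i hi
  rcases lt_or_gt_of_ne hi with h | h
  · exact LVan_of_KVan hθ (hvan i h) ∅
  · exact fun c _ => ⟨0, fun U hU hF => absurd (hcardF U hF) (by omega)⟩


set_option maxHeartbeats 1000000 in
set_option synthInstance.maxHeartbeats 1000000 in
/-- Let `Δ` be a `d`-dimensional connected simplicial complex with `k[Δ]`
Gorenstein on the punctured spectrum.  If `Δ` is a pseudomanifold, then `Δ` is a `k`-homology
manifold. -/
theorem pseudomanifold_homologyManifold
    (k : Type) [Field k] {n : ℕ} (Δ : SC n) (d : ℕ) (hd : Δ.dim = (d : ℤ))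
    (hconn : Δ.Connected) (hGP : GorensteinPunctured k (srIdeal k Δ))
    (hpm : Δ.IsPseudomanifold) :
    Δ.IsHomologyManifold k := by
  exact pm_main k Δ d hd hconn hGP hpm
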